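/- arXiv:1208.5120 — 2 statements merged into one kernel-verified Lean document; each statement's English description precedes it below -/
import Mathlib

section
/- Let e be a properly infinite projection in an AW*-algebra A. Then there exists a nonzero central projection z ≤ c(e) such that ze is equidimensional. -/
universe u

section Defs

variable {R : Type u} [Ring R] [StarRing R]

/-- An element is a projection if it is self-adjoint and idempotent. -/
def IsProjection (p : R) : Prop := star p = p ∧ p * p = p

/-- Order on projections: `e ≤ f` iff `e = ef`. -/
def ProjLE (e f : R) : Prop := e * f = e

/-- Murray–von Neumann equivalence of projections. -/
def ProjEquiv (e f : R) : Prop := ∃ v : R, star v * v = e ∧ v * star v = f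

/-- `e ≼ f` : `e` is equivalent to a subprojection of `f`. -/
def ProjSubEquiv (e f : R) : Prop :=
  ∃ e' : R, IsProjection e' ∧ ProjLE e' f ∧ ProjEquiv e e'

/-- `e ≺ f` : `e ≼ f` but `e` is not equivalent to `f` (with the convention `0 ≺ 0`). -/
def ProjLT (e f : R) : Prop :=
  (ProjSubEquiv e f ∧ ¬ ProjEquiv e f) ∨ (e = 0 ∧ f = 0)

/-- A central projection. -/
def IsCentralProj (z : R) : Prop := IsProjection z ∧ ∀ a : R, z * a = a * z

/-- `c` is the central cover of `e`: the least central projection above `e`. -/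
def IsCentralCover (e c : R) : Prop :=
  IsCentralProj c ∧ ProjLE e c ∧
    ∀ z : R, IsCentralProj z → ProjLE e z → ProjLE c z

/-- A projection `e` is finite if `e ∼ f ≤ e` implies `f = e`. -/
def ProjFinite (e : R) : Prop :=
  ∀ f : R, IsProjection f → ProjEquiv e f → ProjLE f e → f = e

/-- A nonzero projection is properly infinite if `ze` is infinite
for every central projection `z` with `ze ≠ 0`. -/
def ProperlyInfinite (e : R) : Prop :=
  IsProjection e ∧ e ≠ 0 ∧
    ∀ z : R, IsCentralProj z → z * e ≠ 0 → ¬ ProjFinite (z * e)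

/-- A pairwise orthogonal family of elements. -/
def PairwiseOrthogonal {ι : Type*} (p : ι → R) : Prop :=
  ∀ i j, i ≠ j → p i * p j = 0

/-- `s` is the supremum of the family `p` in the projection order. For an
orthogonal family, this is the sum `Σ pᵢ`. -/
def IsSupProj {ι : Type*} (p : ι → R) (s : R) : Prop :=
  IsProjection s ∧ (∀ i, ProjLE (p i) s) ∧
    ∀ t : R, IsProjection t → (∀ i, ProjLE (p i) t) → ProjLE s t

/-- The family `p` belongs to `Γ(e)`: an orthogonal family of projections,
each equivalent to `e`, with sum (supremum) `e`. -/
def InGamma (e : R) {ι : Type u} (p : ι → R) : Prop :=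
  (∀ i, IsProjection (p i)) ∧ PairwiseOrthogonal p ∧
    (∀ i, ProjEquiv (p i) e) ∧ IsSupProj p e

open Classical in
/-- The dimension `d(e)` of a properly infinite projection: the least cardinal
strictly greater than the cardinality of the index set of every family in
`Γ(e)`, with the convention `d(0) = 0`. -/
noncomputable def projDim (e : R) : Cardinal.{u} :=
  if e = 0 then 0
  else sSup {c : Cardinal.{u} |
    ∃ (ι : Type u) (p : ι → R), InGamma e p ∧ c = Order.succ (Cardinal.mk ι)}

/-- A properly infinite projection `e` is equidimensional if `d(ze) = d(e)`
for every central projection `z` with `ze ≠ 0` (equivalently, for every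
nonzero central projection `z ≤ c(e)`). -/
def Equidimensional (e : R) : Prop :=
  ProperlyInfinite e ∧
    ∀ z : R, IsCentralProj z → z * e ≠ 0 → projDim (z * e) = projDim e

/-- An abelian projection: the corner `eRe` is commutative. -/
def IsAbelianProj (e : R) : Prop :=
  IsProjection e ∧ ∀ a b : R, (e * a * e) * (e * b * e) = (e * b * e) * (e * a * e)

/-- `j` is the join `e ∨ f` in the projection lattice. -/
def IsJoinProj (e f j : R) : Prop :=
  IsProjection j ∧ ProjLE e j ∧ ProjLE f j ∧
    ∀ t : R, IsProjection t → ProjLE e t → ProjLE f t → ProjLE j t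

end Defs

/-- The AW*-condition: the right annihilator of any subset is generated by a
projection: `{a | ∀ s ∈ S, s a = 0} = pR`. -/
def IsAWStarRing (R : Type*) [Ring R] [StarRing R] : Prop :=
  ∀ S : Set R, ∃ p : R, IsProjection p ∧
    {a : R | ∀ s ∈ S, s * a = 0} = {a : R | ∃ b : R, a = p * b}

/-- A maximal abelian (*-sub)algebra. -/
def IsMaximalAbelian {A : Type*} [Ring A] [StarRing A] [Algebra ℂ A] [StarModule ℂ A]
    (M : StarSubalgebra ℂ A) : Prop :=
  (∀ x ∈ M, ∀ y ∈ M, x * y = y * x) ∧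
    ∀ N : StarSubalgebra ℂ A, (∀ x ∈ N, ∀ y ∈ N, x * y = y * x) → M ≤ N → M = N

section Helpers

set_option linter.unusedSectionVars false

variable {A : Type u} [NormedRing A] [StarRing A] [CStarRing A]

theorem reas {a b c : A} (h : a * b = c) (x : A) : a * (b * x) = c * x := by
  rw [← mul_assoc, h]

theorem pi_right {v p : A} (h : star v * v = p) (hp : p * p = p) : v * p = v := by
  have hs : star p = p := by rw [← h]; simp
  have : star (v - v * p) * (v - v * p) = 0 := by
    simp only [star_sub, star_mul, hs, sub_mul, mul_sub, mul_assoc, h, reas h, hp]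
    simp
  have := CStarRing.star_mul_self_eq_zero_iff _ |>.1 this
  exact (sub_eq_zero.1 this).symm

theorem pi_left {v q : A} (h : v * star v = q) (hq : q * q = q) : q * v = v := by
  have h1 : star (star v) * star v = q := by simpa using h
  have hs : star q = q := by rw [← h]; simp
  have := congrArg star (pi_right h1 hq)
  simpa [hs] using this

theorem ProjEquiv.symm' {e f : A} (h : ProjEquiv e f) : ProjEquiv f e := by
  obtain ⟨v, h1, h2⟩ := h
  exact ⟨star v, by simpa using h2, by simpa using h1⟩

theorem ProjEquiv.trans' {a b c : A} (hb : IsProjection b) (h : ProjEquiv a b)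
    (h' : ProjEquiv b c) : ProjEquiv a c := by
  obtain ⟨u, h1, h2⟩ := h
  obtain ⟨v, h3, h4⟩ := h'
  have hu := pi_left h2 hb.2
  have hv := pi_right h3 hb.2
  refine ⟨v * u, ?_, ?_⟩
  · simp only [star_mul, mul_assoc, reas h3, hu, h1]
  · simp only [star_mul, mul_assoc, reas h2, reas hv, h4]

theorem proj_refl {a : A} (ha : IsProjection a) : ProjEquiv a a :=
  ⟨a, by rw [ha.1, ha.2], by rw [ha.1, ha.2]⟩

theorem ProjLE.left' {e f : A} (he : IsProjection e) (hf : IsProjection f) (h : ProjLE e f) :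
    f * e = e := by
  have := congrArg star h
  simpa [he.1, hf.1] using this

theorem orth_symm {e f : A} (he : IsProjection e) (hf : IsProjection f) (h : e * f = 0) :
    f * e = 0 := by
  have := congrArg star h
  simpa [he.1, hf.1] using this

theorem proj_sub {e f : A} (he : IsProjection e) (hf : IsProjection f) (h : ProjLE e f) :
    IsProjection (f - e) := by
  refine ⟨by simp [he.1, hf.1], ?_⟩
  have h1 := ProjLE.left' he hf h
  unfold ProjLE at h
  simp only [sub_mul, mul_sub, h, h1, he.2, hf.2]; simp

theorem proj_add {e f : A} (he : IsProjection e) (hf : IsProjection f) (h : e * f = 0) :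
    IsProjection (e + f) := by
  refine ⟨by simp [he.1, hf.1], ?_⟩
  have h1 := orth_symm he hf h
  simp only [add_mul, mul_add, h, h1, he.2, hf.2]; simp

theorem proj_conj {v e h : A} (hv : star v * v = e) (hh : IsProjection h) (hhe : h * e = h) :
    IsProjection (v * h * star v) := by
  refine ⟨by simp [hh.1, mul_assoc], ?_⟩
  simp only [mul_assoc, reas hv, reas hhe, reas hh.2]

theorem exists_inf (hAW : IsAWStarRing A) (S : Set A) :
    ∃ q : A, IsProjection q ∧ (∀ p ∈ S, p * q = q) ∧
      ∀ t : A, (∀ p ∈ S, p * t = t) → q * t = t := by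
  obtain ⟨q, hq, h⟩ := hAW {x | ∃ p ∈ S, x = 1 - p}
  refine ⟨q, hq, ?_, ?_⟩
  · intro p hp
    have : q ∈ {a : A | ∃ b, a = q * b} := ⟨q, hq.2.symm⟩
    rw [← h] at this
    have := this (1 - p) ⟨p, hp, rfl⟩
    rw [sub_mul, one_mul, sub_eq_zero] at this
    exact this.symm
  · intro t ht
    have : t ∈ {a : A | ∀ s ∈ {x | ∃ p ∈ S, x = 1 - p}, s * a = 0} := by
      rintro s ⟨p, hp, rfl⟩
      rw [sub_mul, ht p hp]; simp
    rw [h] at this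
    obtain ⟨b, rfl⟩ := this
    rw [reas hq.2]

theorem exists_sup (hAW : IsAWStarRing A) {ι : Type*} (p : ι → A) :
    ∃ s : A, IsSupProj p s := by
  obtain ⟨q, hq, h⟩ := hAW (Set.range p)
  have hs : IsProjection (1 - q) := ⟨by simp [hq.1], by simp [mul_sub, sub_mul, hq.2]⟩
  refine ⟨1 - q, hs, ?_, ?_⟩
  · intro i
    have : q ∈ {a : A | ∃ b, a = q * b} := ⟨q, hq.2.symm⟩
    rw [← h] at this
    have := this (p i) ⟨i, rfl⟩
    simp [ProjLE, mul_sub, this]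
  · intro t ht hp
    have : 1 - t ∈ {a : A | ∀ s ∈ Set.range p, s * a = 0} := by
      rintro _ ⟨i, rfl⟩
      rw [mul_sub, hp i]; simp
    rw [h] at this
    obtain ⟨b, hb⟩ := this
    have h2 : q * (1 - t) = 1 - t := by rw [hb, reas hq.2]
    unfold ProjLE
    have h3 : t = 1 - (1 - t) := by abel
    rw [sub_mul, one_mul]
    rw [mul_sub, mul_one] at h2
    have : q * t = q - (1 - t) := by rw [← h2]; abel
    rw [this]; abel

theorem exists_central_ann (hAW : IsAWStarRing A) (Z : Set A)
    (hZ : ∀ z ∈ Z, ∀ a : A, z * a = a * z) :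
    ∃ q : A, IsCentralProj q ∧ (∀ z ∈ Z, z * q = 0) ∧
      ∀ x : A, (∀ z ∈ Z, z * x = 0) → q * x = x := by
  obtain ⟨q, hq, h⟩ := hAW Z
  have h1 : ∀ z ∈ Z, z * q = 0 := by
    have : q ∈ {a : A | ∃ b, a = q * b} := ⟨q, hq.2.symm⟩
    rw [← h] at this
    exact this
  have h2 : ∀ x : A, (∀ z ∈ Z, z * x = 0) → q * x = x := by
    intro x hx
    have : x ∈ {a : A | ∀ s ∈ Z, s * a = 0} := hx
    rw [h] at this
    obtain ⟨b, rfl⟩ := this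
    rw [reas hq.2]
  have h3 : ∀ a, q * (a * q) = a * q := fun a => h2 _ fun z hz => by
    rw [← mul_assoc, hZ z hz, mul_assoc, h1 z hz, mul_zero]
  refine ⟨q, ⟨hq, fun a => ?_⟩, h1, h2⟩
  have h4 := congrArg star (h3 (star a))
  simp only [star_mul, star_star, hq.1, mul_assoc] at h4
  rw [← h4, h3]

/-- Schroeder-Bernstein. -/
theorem schroeder (hAW : IsAWStarRing A) {a b e : A} (ha : IsProjection a)
    (hb : IsProjection b) (he : IsProjection e) (hab : ProjLE a b) (hbe : ProjLE b e)
    (h : ProjEquiv e a) : ProjEquiv e b := by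
  obtain ⟨v, hv1, hv2⟩ := h
  have hve := pi_right hv1 he.2
  have hav := pi_left hv2 ha.2
  have hba := ProjLE.left' ha hb hab
  have heb := ProjLE.left' hb he hbe
  unfold ProjLE at hab hbe
  have hsv : star v * a = star v := by have := congrArg star hav; simpa [ha.1] using this
  have hesv : e * star v = star v := by have := congrArg star hve; simpa [he.1] using this
  have hr : IsProjection (e - b) := proj_sub hb he hbe
  have hra : (e - b) * a = 0 := by
    rw [sub_mul, hba, ← hba, reas heb, sub_self]
  have hrv : (e - b) * v = 0 := by rw [← hav, ← mul_assoc, hra, zero_mul]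
  let S : Set A := {h | IsProjection h ∧ h * e = h ∧ h * (e - b) = e - b ∧
    h * (v * h * star v) = v * h * star v}
  have heS : e ∈ S := by
    refine ⟨he, he.2, by rw [mul_sub, he.2, heb], ?_⟩
    rw [hve, hv2, ← hba, reas heb]
  obtain ⟨q, hq, hq1, hq2⟩ := exists_inf hAW S
  have heq := hq1 e heS
  have hqe : q * e = q := by have := congrArg star heq; simpa [he.1, hq.1] using this
  have hqr : q * (e - b) = e - b := hq2 _ fun p hp => hp.2.2.1
  have hqv : q * (v * q * star v) = v * q * star v := by
    apply hq2
    intro p hp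
    have h1 := hq1 p hp
    have h2 := hp.2.2.2
    have h3 : v * q * star v = v * p * star v * (v * q * star v) := by
      simp only [mul_assoc, reas hv1, reas heq, reas h1]
    rw [h3, ← mul_assoc, h2]
  have hc : IsProjection (v * q * star v) := proj_conj hv1 hq hqe
  have hrc : (e - b) * (v * q * star v) = 0 := by
    simp only [← mul_assoc, hrv, zero_mul]
  have hcr := orth_symm hr hc hrc
  have hec : e * (v * q * star v) = v * q * star v := by
    rw [← hqv, reas heq]
  have hce : (v * q * star v) * e = v * q * star v := by
    have := congrArg star hec; simpa [he.1, hq.1, mul_assoc] using this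
  have hcq : (v * q * star v) * q = v * q * star v := by
    have := congrArg star hqv; simpa [hq.1, mul_assoc] using this
  have hrq : (e - b) * q = e - b := by
    have := congrArg star hqr; simpa [hq.1, he.1, hb.1] using this
  have htS : (e - b) + v * q * star v ∈ S := by
    have hre : (e - b) * e = e - b := by rw [sub_mul, he.2, hbe]
    refine ⟨proj_add hr hc hrc, by rw [add_mul, hre, hce], by rw [add_mul, hr.2, hcr, add_zero], ?_⟩
    have h1 : v * ((e - b) + v * q * star v) * star v = (v * q * star v) *
        (v * ((e - b) + v * q * star v) * star v) := by
      have : q * ((e - b) + v * q * star v) = (e - b) + v * q * star v := by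
        rw [mul_add, hqr, hqv]
      calc _ = v * (q * ((e - b) + v * q * star v)) * star v := by rw [this]
        _ = v * (q * e * ((e - b) + v * q * star v)) * star v := by rw [hqe]
        _ = _ := by rw [← hv1]; simp only [mul_assoc]
    rw [h1, ← mul_assoc, add_mul _ _ (v * q * star v), hrc, hc.2, zero_add]
  have hfix : (e - b) + v * q * star v = q := by
    have h1 := hq1 _ htS
    rw [add_mul, hrq, hcq] at h1
    exact h1
  -- w = v q + (e - q)
  have hqc : v * q * star v = q - (e - b) := by
    nth_rewrite 2 [← hfix]; abel
  have hvq : (e - q) * (v * q) = 0 := by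
    have : v * q = (v * q * star v) * (v * q) := by
      simp only [mul_assoc, reas hv1, heq, hq.2]
    rw [this, ← mul_assoc, sub_mul, hec, hqv, sub_self, zero_mul]
  have hvq' : q * (star v * (e - q)) = 0 := by
    have := congrArg star hvq
    simpa [he.1, hq.1, mul_assoc] using this
  have hp := proj_sub hq he hqe
  have hqp : q * (e - q) = 0 := by rw [mul_sub, hqe, hq.2, sub_self]
  have hpq : (e - q) * q = 0 := by rw [sub_mul, heq, hq.2, sub_self]
  refine ⟨v * q + (e - q), ?_, ?_⟩
  · have : star (v * q + (e - q)) = q * star v + (e - q) := by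
      simp [hq.1, he.1]
    rw [this, add_mul, mul_add, mul_add, hp.2, hvq, mul_assoc, mul_assoc, hvq', reas hv1, heq, hq.2]
    abel
  · have : star (v * q + (e - q)) = q * star v + (e - q) := by
      simp [hq.1, he.1]
    rw [this, add_mul, mul_add, mul_add, hp.2, mul_assoc, mul_assoc, hqp, reas hq.2, reas hpq,
      ← mul_assoc, hqc]
    simp

theorem equiv_add {P₁ P₂ Q₁ Q₂ : A} (hP₁ : IsProjection P₁) (hP₂ : IsProjection P₂)
    (hQ₁ : IsProjection Q₁) (hQ₂ : IsProjection Q₂) (hP : P₁ * P₂ = 0) (hQ : Q₁ * Q₂ = 0)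
    (h₁ : ProjEquiv P₁ Q₁) (h₂ : ProjEquiv P₂ Q₂) : ProjEquiv (P₁ + P₂) (Q₁ + Q₂) := by
  obtain ⟨u, hu1, hu2⟩ := h₁
  obtain ⟨v, hv1, hv2⟩ := h₂
  have a1 := pi_right hu1 hP₁.2
  have a2 := pi_right hv1 hP₂.2
  have b1 := pi_left hu2 hQ₁.2
  have b2 := pi_left hv2 hQ₂.2
  have c1 : star u * v = 0 := by
    rw [← b1, ← b2, star_mul, hQ₁.1, mul_assoc, reas hQ]; simp
  have c2 : star v * u = 0 := by simpa using congrArg star c1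
  have d1 : u * star v = 0 := by
    rw [← a1, ← a2, star_mul, hP₂.1, mul_assoc, reas hP]; simp
  have d2 : v * star u = 0 := by simpa using congrArg star d1
  refine ⟨u + v, ?_, ?_⟩
  · rw [star_add, add_mul, mul_add, mul_add, c1, c2, hu1, hv1]; simp
  · rw [star_add, add_mul, mul_add, mul_add, d1, d2, hu2, hv2]; simp

/-- Orthogonal family of copies of `f` below `f`. -/
def Fam {K : Type*} (f : A) (p : K → A) : Prop :=
  (∀ k, IsProjection (p k)) ∧ PairwiseOrthogonal p ∧ (∀ k, p k * f = p k) ∧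
    ∀ k, ProjEquiv f (p k)

open Classical in
theorem absorb (hAW : IsAWStarRing A) {K : Type u} [Nonempty K] {f : A} (hf : IsProjection f)
    {p : K → A} (hp : Fam f p) : ∃ p' : K → A, InGamma f p' := by
  obtain ⟨k0⟩ := ‹Nonempty K›
  obtain ⟨h1, h2, h3, h4⟩ := hp
  obtain ⟨s, hs, hs1, hs2⟩ := exists_sup hAW (fun k : {k // k ≠ k0} => p k)
  have hsf : ProjLE s f := hs2 f hf fun k => h3 k
  have hfs := ProjLE.left' hs hf hsf
  have hr := proj_sub hs hf hsf
  have hk0 : IsProjection (1 - p k0) := ⟨by simp [(h1 k0).1], by simp [mul_sub, sub_mul, (h1 k0).2]⟩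
  have hsk : s * p k0 = 0 := by
    have : ProjLE s (1 - p k0) := hs2 _ hk0 fun k => by
      simp [ProjLE, mul_sub, h2 k k0 k.2]
    simpa [ProjLE, mul_sub] using this
  have hks := orth_symm hs (h1 k0) hsk
  have hne : ∀ k, k ≠ k0 → p k * (f - s) = 0 := fun k hk => by
    have : p k * s = p k := hs1 ⟨k, hk⟩
    rw [mul_sub, h3, this, sub_self]
  refine ⟨Function.update p k0 (f - s), ?_, ?_, ?_, hf, ?_, ?_⟩
  · intro k
    by_cases hk : k = k0
    · subst hk; simpa using hr
    · simpa [hk] using h1 k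
  · intro i j hij
    by_cases hi : i = k0
    · subst hi
      have hj : j ≠ i := hij.symm
      simp only [Function.update_self, Function.update_of_ne hj]
      exact orth_symm (h1 j) hr (hne j hj)
    · by_cases hj : j = k0
      · subst hj
        simp only [Function.update_self, Function.update_of_ne hi]
        exact hne i hi
      · simp only [Function.update_of_ne hj, Function.update_of_ne hi]
        exact h2 i j hij
  · intro k
    by_cases hk : k = k0
    · subst hk
      simp only [Function.update_self]
      refine ProjEquiv.symm' (schroeder hAW (h1 k) hr hf ?_ ?_ (h4 k))
      · simp [ProjLE, mul_sub, hks, h3]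
      · simp only [ProjLE, sub_mul, hf.2]; rw [hsf]
    · simp only [Function.update_of_ne hk]
      exact (h4 k).symm'
  · intro k
    by_cases hk : k = k0
    · subst hk
      simp only [Function.update_self]
      simp only [ProjLE, sub_mul, hf.2]; rw [hsf]
    · simp only [Function.update_of_ne hk]; exact h3 k
  · intro t ht hall
    have e1 : s * t = s := hs2 t ht fun k => by simpa [k.2] using hall k
    have e2 : (f - s) * t = f - s := by simpa [ProjLE] using hall k0
    unfold ProjLE
    rw [sub_mul, e1] at e2
    exact sub_left_injective e2

theorem two_to_nat {f p q : A} (hf : IsProjection f) (hp : IsProjection p) (hq : IsProjection q)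
    (hpq : p * q = 0) (hpf : p * f = p) (hqf : q * f = q) (ep : ProjEquiv f p)
    (eq : ProjEquiv f q) : ∃ r : ℕ → A, Fam f r := by
  obtain ⟨v, hv1, hv2⟩ := ep
  obtain ⟨w, hw1, hw2⟩ := eq
  have hqp := orth_symm hp hq hpq
  have hvf := pi_right hv1 hf.2
  have hpv := pi_left hv2 hp.2
  have hwf := pi_right hw1 hf.2
  have hqw := pi_left hw2 hq.2
  have hfp := ProjLE.left' hp hf hpf
  have hfq := ProjLE.left' hq hf hqf
  have hfv : f * v = v := by rw [← hpv, reas hfp]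
  have hfw : f * w = w := by rw [← hqw, reas hfq]
  have hwv : star w * v = 0 := by
    rw [← hqw, ← hpv, star_mul, hq.1, mul_assoc, reas hqp]; simp
  have hfvn : ∀ n, f * (v ^ n * w) = v ^ n * w := by
    intro n
    cases n with
    | zero => simpa using hfw
    | succ n => rw [pow_succ', mul_assoc, reas hfv]
  have key : ∀ n, star v ^ n * (v ^ n * w) = w := by
    intro n
    induction n with
    | zero => simp
    | succ n ih =>
      rw [pow_succ (star v), pow_succ' v, mul_assoc, mul_assoc v, reas hv1, hfvn, ih]
  have iso : ∀ n, star (v ^ n * w) * (v ^ n * w) = f := by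
    intro n
    rw [star_mul, star_pow, mul_assoc, key, hw1]
  have lt : ∀ n m, star (v ^ n * w) * (v ^ (n + (m + 1)) * w) = 0 := by
    intro n m
    have : star v ^ n * (v ^ (n + (m+1)) * w) = v ^ (m + 1) * w := by
      induction n with
      | zero => simp
      | succ n ih =>
        rw [show n + 1 + (m + 1) = (n + (m + 1)) + 1 by ring, pow_succ (star v), pow_succ' v,
          mul_assoc, mul_assoc v, reas hv1, hfvn, ih]
    rw [star_mul, star_pow, mul_assoc, this, pow_succ', mul_assoc, reas hwv, zero_mul]
  have ltt : ∀ n m, n < m → star (v ^ n * w) * (v ^ m * w) = 0 := by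
    intro n m h
    obtain ⟨k, rfl⟩ := Nat.exists_eq_add_of_lt h
    exact lt n k
  have ne : ∀ n m, n ≠ m → star (v ^ n * w) * (v ^ m * w) = 0 := by
    intro n m h
    rcases lt_or_gt_of_ne h with h | h
    · exact ltt n m h
    · simpa only [star_mul, star_star, star_zero] using congrArg star (ltt m n h)
  refine ⟨fun n => (v ^ n * w) * star (v ^ n * w), ?_, ?_, ?_, ?_⟩
  · intro n
    refine ⟨by simp, ?_⟩
    have := pi_right (iso n) hf.2
    rw [mul_assoc, reas (iso n), ← mul_assoc, this]
  · intro n m h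
    show _ * _ * (_ * _) = 0
    rw [mul_assoc, reas (ne n m h)]; simp
  · intro n
    have := congrArg star (hfvn n)
    rw [star_mul, hf.1] at this
    show _ * _ * _ = _
    rw [mul_assoc, this]
  · intro n
    exact ⟨v ^ n * w, iso n, rfl⟩

theorem central_mul_proj {z p : A} (hz : IsCentralProj z) (hp : IsProjection p) :
    IsProjection (z * p) := by
  refine ⟨by rw [star_mul, hp.1, hz.1.1, hz.2], ?_⟩
  rw [mul_assoc, ← mul_assoc p, ← hz.2 p, mul_assoc, hp.2, reas hz.1.2]

theorem central_mul {z y : A} (hz : IsCentralProj z) (hy : IsCentralProj y) :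
    IsCentralProj (z * y) :=
  ⟨central_mul_proj hz hy.1, fun a => by rw [mul_assoc, hy.2, ← mul_assoc, hz.2, mul_assoc]⟩

section Glue

variable {I : Type*} {z : I → A} {f : A}

theorem glue_sup (hAW : IsAWStarRing A) (hz : ∀ i, IsCentralProj (z i))
    (hzo : ∀ i j, i ≠ j → z i * z j = 0) (hf : IsProjection f)
    (g : I → A) (hg : ∀ i, IsProjection (g i)) (hzg : ∀ i, z i * g i = g i)
    (hgf : ∀ i, g i * f = g i) :
    ∃ G, IsProjection G ∧ G * f = G ∧ ∀ i, z i * G = g i := by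
  obtain ⟨G, hG, h1, h2⟩ := exists_sup hAW g
  refine ⟨G, hG, h2 f hf hgf, fun i => ?_⟩
  have hgG : g i * G = g i := h1 i
  have hGg := ProjLE.left' (hg i) hG (h1 i)
  have hgz : g i * z i = g i := by rw [← (hz i).2, hzg]
  have hzG := central_mul_proj (hz i) hG
  have hA : ProjLE (z i * G) G := by rw [ProjLE, mul_assoc, hG.2]
  have hB := proj_sub hzG hG hA
  have hBg : (G - z i * G) * g i = 0 := by
    rw [sub_mul, mul_assoc, hGg, hzg, sub_self]
  have ht := proj_add hB (hg i) hBg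
  have : ProjLE G (G - z i * G + g i) := by
    refine h2 _ ht fun j => ?_
    have hjG : g j * G = g j := h1 j
    by_cases hij : j = i
    · subst hij
      rw [ProjLE, mul_add, (hg j).2, orth_symm hB (hg j) hBg, zero_add]
    · have e1 : g j * g i = 0 := by
        have hgz : g j * z j = g j := by rw [← (hz j).2, hzg]
        rw [← hgz, ← hzg i, mul_assoc, reas (hzo j i hij)]; simp
      have e2 : g j * z i = 0 := by
        have hgz : g j * z j = g j := by rw [← (hz j).2, hzg]
        rw [← hgz, mul_assoc, hzo j i hij, mul_zero]
      rw [ProjLE, mul_add, mul_sub, e1, hjG, reas e2]; simp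
  have h3 := ProjLE.left' hG ht this
  have h4 := congrArg (z i * ·) h3
  rw [← h4, add_mul, hgG, mul_add, hzg, sub_mul, mul_sub, hG.2, mul_assoc, hG.2, reas (hz i).1.2,
    sub_self, zero_add]

theorem glue_equiv (hAW : IsAWStarRing A) (hz : ∀ i, IsCentralProj (z i))
    (hzo : ∀ i j, i ≠ j → z i * z j = 0) (hf : IsProjection f)
    (hD : ∀ x, f * x = x → (∀ i, z i * x = 0) → x = 0)
    {c : A} (hc : c + c = 1) (hcc : ∀ a, c * a = a * c) (hcs : star c = c)
    {P Q : A} (hP : IsProjection P) (hQ : IsProjection Q) (hPQ : P * Q = 0)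
    (hPf : P * f = P) (hQf : Q * f = Q) (h : ∀ i, ProjEquiv (z i * P) (z i * Q)) :
    ProjEquiv P Q := by
  choose w hw1 hw2 using h
  have hzP := fun i => central_mul_proj (hz i) hP
  have hzQ := fun i => central_mul_proj (hz i) hQ
  have hQP := orth_symm hP hQ hPQ
  have hfP := ProjLE.left' hP hf hPf
  have hfQ := ProjLE.left' hQ hf hQf
  have a1 := fun i => pi_right (hw1 i) (hzP i).2
  have b1 := fun i => pi_left (hw2 i) (hzQ i).2
  have hzw : ∀ i, z i * w i = w i := fun i => by rw [← b1, mul_assoc, reas (hz i).1.2]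
  have hQw : ∀ i, Q * w i = w i := fun i => by
    rw [← b1, (hz i).2, mul_assoc, reas hQ.2]
  have hwP : ∀ i, w i * P = w i := fun i => by
    rw [← a1, mul_assoc, mul_assoc, hP.2]
  have hPw : ∀ i, P * w i = 0 := fun i => by rw [← hQw, reas hPQ, zero_mul]
  have hwQ : ∀ i, w i * Q = 0 := fun i => by rw [← hwP, mul_assoc, hPQ, mul_zero]
  have st : ∀ {a b d : A}, a * b = d → star b * star a = star d := fun h => by rw [← h, star_mul]
  have hzw' : ∀ i, z i * star (w i) = star (w i) := fun i => by
    rw [(hz i).2]; simpa [(hz i).1.1] using st (hzw i)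
  have hQw' : ∀ i, star (w i) * Q = star (w i) := fun i => by simpa [hQ.1] using st (hQw i)
  have hwP' : ∀ i, P * star (w i) = star (w i) := fun i => by simpa [hP.1] using st (hwP i)
  have hPw' : ∀ i, star (w i) * P = 0 := fun i => by simpa [hP.1] using st (hPw i)
  have hwQ' : ∀ i, Q * star (w i) = 0 := fun i => by simpa [hQ.1] using st (hwQ i)
  have hww : ∀ i, w i * w i = 0 := fun i => by
    rw [← hwP, mul_assoc, hwP, hPw, mul_zero]
  have hww' : ∀ i, star (w i) * star (w i) = 0 := fun i => by simpa using st (hww i)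
  let T : I → A := fun i => z i * P + z i * Q + w i + star (w i)
  have hT : ∀ i, T i * T i = T i + T i := by
    intro i
    have p1 : z i * P * (z i * P) = z i * P := (hzP i).2
    have p2 : z i * P * (z i * Q) = 0 := by rw [mul_assoc, ← mul_assoc P, ← (hz i).2 P, mul_assoc, hPQ]; simp
    have p3 : z i * P * w i = 0 := by rw [mul_assoc, hPw, mul_zero]
    have p4 : z i * P * star (w i) = star (w i) := by rw [mul_assoc, hwP', hzw']
    have q1 : z i * Q * (z i * Q) = z i * Q := (hzQ i).2
    have q2 : z i * Q * (z i * P) = 0 := by rw [mul_assoc, ← mul_assoc Q, ← (hz i).2 Q, mul_assoc, hQP]; simp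
    have q3 : z i * Q * w i = w i := b1 i
    have q4 : z i * Q * star (w i) = 0 := by rw [mul_assoc, hwQ', mul_zero]
    have r1 : w i * (z i * P) = w i := a1 i
    have r2 : w i * (z i * Q) = 0 := by rw [(hz i).2, ← mul_assoc, hwQ, zero_mul]
    have s1 : star (w i) * (z i * P) = 0 := by rw [(hz i).2, ← mul_assoc, hPw', zero_mul]
    have s2 : star (w i) * (z i * Q) = star (w i) := by
      rw [(hz i).2, ← mul_assoc, hQw', ← (hz i).2, hzw']
    simp only [T, add_mul, mul_add, p1, p2, p3, p4, q1, q2, q3, q4, r1, r2, s1, s2, hww, hww', hw1, hw2]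
    abel
  have hTs : ∀ i, star (T i) = T i := by
    intro i
    simp only [T, star_add, star_star, (hzP i).1, (hzQ i).1]; abel
  have hcT : ∀ i, c * T i + c * T i = T i := fun i => by rw [← add_mul, hc, one_mul]
  have hzT : ∀ i, z i * T i = T i := fun i => by
    simp only [T, mul_add, reas (hz i).1.2, hzw, hzw']
  have hfw : ∀ i, w i * f = w i := fun i => by rw [← hwP, mul_assoc, hPf]
  have hfw' : ∀ i, star (w i) * f = star (w i) := fun i => by rw [← hQw', mul_assoc, hQf]
  have hTf : ∀ i, T i * f = T i := fun i => by
    simp only [T, add_mul, mul_assoc, hPf, hQf, hfw, hfw']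
  obtain ⟨G, hG, hGf, hGz⟩ := glue_sup hAW hz hzo hf (fun i => c * T i)
    (fun i => ⟨by rw [star_mul, hTs, hcs, hcc], by
      rw [mul_assoc, ← mul_assoc (T i), ← hcc (T i), mul_assoc, hT, mul_add, hcT]⟩)
    (fun i => by rw [← mul_assoc, ← hcc, mul_assoc, hzT]) (fun i => by rw [mul_assoc, hTf])
  let v := Q * (G + G) * P
  have hv : ∀ i, z i * v = w i := by
    intro i
    have e1 : z i * (G + G) = T i := by rw [mul_add, hGz, hcT]
    have e2 : Q * T i = z i * Q + w i := by
      simp only [T, mul_add, hQw, hwQ']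
      rw [← mul_assoc, ← (hz i).2, mul_assoc, hQP, ← mul_assoc, ← (hz i).2, mul_assoc, hQ.2]; simp
    calc z i * v = Q * (z i * (G + G)) * P := by
          simp only [v]; rw [← mul_assoc Q (z i), ← (hz i).2 Q]; simp only [mul_assoc]
      _ = w i := by rw [e1, e2, add_mul, mul_assoc, hQP, hwP]; simp
  have hv' : ∀ i, z i * star v = star (w i) := fun i => by
    rw [(hz i).2]; simpa [(hz i).1.1] using st (hv i)
  have hQv : Q * v = v := by simp only [v, ← mul_assoc, hQ.2]
  have hPv : P * star v = star v := by
    have : v * P = v := by simp only [v, mul_assoc, hP.2]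
    simpa [hP.1] using st this
  have hfv : f * v = v := by rw [← hQv, reas hfQ]
  have hfv' : f * star v = star v := by rw [← hPv, reas hfP]
  refine ⟨v, ?_, ?_⟩
  · refine sub_eq_zero.1 (hD _ ?_ fun i => ?_)
    · rw [mul_sub, reas hfv', hfP]
    · rw [mul_sub, ← (hz i).1.2, mul_assoc, ← mul_assoc (z i) (star v), hv', ← mul_assoc, (hz i).2,
        mul_assoc, hv, hw1, mul_assoc, reas (hz i).1.2, sub_self]
  · refine sub_eq_zero.1 (hD _ ?_ fun i => ?_)
    · rw [mul_sub, reas hfv, hfQ]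
    · rw [mul_sub, ← (hz i).1.2, mul_assoc, ← mul_assoc (z i) v, hv, ← mul_assoc, (hz i).2,
        mul_assoc, hv', hw2, mul_assoc, reas (hz i).1.2, sub_self]

theorem glue_fam (hAW : IsAWStarRing A) (hz : ∀ i, IsCentralProj (z i))
    (hzo : ∀ i j, i ≠ j → z i * z j = 0) (hf : IsProjection f)
    (hD : ∀ x, f * x = x → (∀ i, z i * x = 0) → x = 0)
    {c : A} (hc : c + c = 1) (hcc : ∀ a, c * a = a * c) (hcs : star c = c)
    {K : Type*} [Infinite K] (p : I → K → A) (hp : ∀ i, Fam (z i * f) (p i)) :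
    ∃ E : K → A, Fam f E := by
  have hzf := fun i => central_mul_proj (hz i) hf
  have hfz : ∀ i, z i * f * f = z i * f := fun i => by rw [mul_assoc, hf.2]
  have hzp : ∀ i k, z i * p i k = p i k := fun i k => by
    have := ProjLE.left' ((hp i).1 k) (hzf i) ((hp i).2.2.1 k)
    rw [← this, mul_assoc, reas (hz i).1.2]
  have hpf : ∀ i k, p i k * f = p i k := fun i k => by
    rw [← (hp i).2.2.1 k, mul_assoc, hfz]
  have hex := fun k => glue_sup hAW hz hzo hf (fun i => p i k) (fun i => (hp i).1 k)
    (fun i => hzp i k) (fun i => hpf i k)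
  choose E hE hEf hEz using hex
  have hfE : ∀ k, f * E k = E k := fun k => ProjLE.left' (hE k) hf (hEf k)
  have hEo : ∀ k l, k ≠ l → E k * E l = 0 := by
    intro k l hkl
    refine hD _ (reas (hfE k) _) fun i => ?_
    rw [← (hz i).1.2, mul_assoc, ← mul_assoc (z i) (E k), hEz, ← mul_assoc, (hz i).2, mul_assoc, hEz]
    exact (hp i).2.1 k l hkl
  have hEE : ∀ k l, k ≠ l → ProjEquiv (E k) (E l) := by
    intro k l hkl
    refine glue_equiv hAW hz hzo hf hD hc hcc hcs (hE k) (hE l) (hEo k l hkl) (hEf k) (hEf l)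
      fun i => ?_
    rw [hEz, hEz]
    exact ProjEquiv.trans' (hzf i) ((hp i).2.2.2 k).symm' ((hp i).2.2.2 l)
  refine ⟨E, hE, hEo, hEf, fun k => ?_⟩
  classical
  obtain ⟨k1, hk1⟩ := Infinite.exists_notMem_finset ({k} : Finset K)
  obtain ⟨k2, hk2⟩ := Infinite.exists_notMem_finset ({k, k1} : Finset K)
  simp only [Finset.mem_singleton, Finset.mem_insert, not_or] at hk1 hk2
  have hQ := proj_sub (hE k) hf (hEf k)
  have hQf : (f - E k) * f = f - E k := by rw [sub_mul, hf.2, hEf]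
  have hEQ : E k * (f - E k) = 0 := by rw [mul_sub, hEf, (hE k).2, sub_self]
  have hlQ : ∀ l, l ≠ k → E l * (f - E k) = E l := fun l hl => by
    rw [mul_sub, hEf, hEo l k hl, sub_zero]
  have hkQ : ProjEquiv (E k) (f - E k) := by
    refine glue_equiv hAW hz hzo hf hD hc hcc hcs (hE k) hQ hEQ (hEf k) hQf fun i => ?_
    have h1 : ProjEquiv (z i * f) (z i * (f - E k)) := by
      refine schroeder hAW ((hp i).1 k1) (central_mul_proj (hz i) hQ) (hzf i) ?_ ?_
        ((hp i).2.2.2 k1)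
      · rw [ProjLE, ← hEz, mul_assoc, ← mul_assoc (E k1), ← (hz i).2 (E k1), mul_assoc,
          hlQ k1 hk1, reas (hz i).1.2]
      · rw [ProjLE, mul_assoc, ← mul_assoc (f - E k), ← (hz i).2 (f - E k), mul_assoc, hQf,
          reas (hz i).1.2]
    rw [hEz]
    exact ProjEquiv.trans' (hzf i) ((hp i).2.2.2 k).symm' h1
  have h12 : E k2 * E k1 = 0 := hEo _ _ hk2.2
  have hsum : ProjEquiv (E k + (f - E k)) (E k2 + E k1) :=
    equiv_add (hE k) hQ (hE k2) (hE k1) hEQ h12 (hEE _ _ (Ne.symm hk2.1))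
      (ProjEquiv.trans' (hE k) hkQ.symm' (hEE _ _ (Ne.symm hk1)))
  rw [add_sub_cancel] at hsum
  refine ProjEquiv.trans' hQ (schroeder hAW (proj_add (hE k2) (hE k1) h12) hQ hf ?_ hQf hsum)
    hkQ.symm'
  rw [ProjLE, add_mul, hlQ _ hk1, hlQ _ hk2.1]

end Glue

theorem gamma_card {f : A} (hf : f ≠ 0) (hfp : IsProjection f) {ι : Type u} {p : ι → A}
    (hp : InGamma f p) : Cardinal.mk ι ≤ Cardinal.mk A := by
  refine Cardinal.mk_le_of_injective (f := p) fun i j hij => ?_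
  by_contra hne
  have h1 := hp.2.1 i j hne
  rw [← hij, (hp.1 i).2] at h1
  obtain ⟨v, hv1, hv2⟩ := hp.2.2.1 i
  rw [h1] at hv1
  apply hf
  rw [← hfp.2, ← hv2, mul_assoc, reas hv1]; simp

theorem lt_projDim {f : A} (hf : f ≠ 0) (hfp : IsProjection f) {ι : Type u} {p : ι → A}
    (hp : InGamma f p) : Cardinal.mk ι < projDim f := by
  rw [projDim, if_neg hf]
  refine lt_of_lt_of_le (Order.lt_succ _) (le_csSup ?_ ⟨ι, p, hp, rfl⟩)
  refine ⟨Order.succ (Cardinal.mk A), ?_⟩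
  rintro _ ⟨κ, q, hq, rfl⟩
  exact Order.succ_le_succ (gamma_card hf hfp hq)

theorem one_lt_projDim {f : A} (hf : f ≠ 0) (hfp : IsProjection f) : 1 < projDim f := by
  have : InGamma f (fun _ : PUnit.{u+1} => f) :=
    ⟨fun _ => hfp, fun i j h => absurd (Subsingleton.elim i j) h, fun _ => proj_refl hfp,
      hfp, fun _ => hfp.2, fun t _ h => h PUnit.unit⟩
  simpa using lt_projDim hf hfp this

theorem exists_of_lt_projDim {f : A} {δ : Cardinal.{u}} (h : δ < projDim f) :
    ∃ (ι : Type u) (p : ι → A), InGamma f p ∧ δ ≤ Cardinal.mk ι := by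
  unfold projDim at h
  split_ifs at h with h0
  · exact absurd h (not_lt.2 zero_le)
  · obtain ⟨c, ⟨ι, p, hp, rfl⟩, hc⟩ := exists_lt_of_lt_csSup' h
    exact ⟨ι, p, hp, Order.lt_succ_iff.1 hc⟩

theorem fam_of_lt {f : A} (hfp : IsProjection f) {δ : Cardinal.{u}} (hδ : 1 < δ)
    (h : δ < projDim f) {K : Type u} (hK : Cardinal.mk K = max δ Cardinal.aleph0) :
    ∃ p : K → A, Fam f p := by
  obtain ⟨ι, p, hp, hι⟩ := exists_of_lt_projDim h
  have hfam : Fam f p := ⟨hp.1, hp.2.1, hp.2.2.2.2.1, fun k => (hp.2.2.1 k).symm'⟩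
  have key : ∀ {J : Type u} {q : J → A}, Fam f q → Cardinal.mk K ≤ Cardinal.mk J →
      ∃ p : K → A, Fam f p := by
    intro J q hq hJ
    obtain ⟨g⟩ := hJ
    exact ⟨fun k => q (g k), fun k => hq.1 _, fun i j hij => hq.2.1 _ _ (g.injective.ne hij),
      fun k => hq.2.2.1 _, fun k => hq.2.2.2 _⟩
  rcases lt_or_ge (Cardinal.mk ι) Cardinal.aleph0 with hfin | hinf
  · have : Nontrivial ι := Cardinal.one_lt_iff_nontrivial.1 (lt_of_lt_of_le hδ hι)
    obtain ⟨i, j, hij⟩ := exists_pair_ne ι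
    obtain ⟨r, hr⟩ := two_to_nat hfp (hp.1 i) (hp.1 j) (hp.2.1 i j hij) (hfam.2.2.1 i)
      (hfam.2.2.1 j) (hfam.2.2.2 i) (hfam.2.2.2 j)
    refine key (J := ULift.{u} ℕ) (q := fun n => r n.down) ⟨fun k => hr.1 _, fun i j hij =>
      hr.2.1 _ _ fun h => hij (ULift.ext _ _ h), fun k => hr.2.2.1 _, fun k => hr.2.2.2 _⟩ ?_
    rw [hK, max_eq_right (hι.trans hfin.le)]
    simp
  · exact key hfam (by rw [hK]; exact max_le hι hinf)

end Helpers

/-- For any properly infinite projection `e` there is a nonzero central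
projection `z ≤ c(e)` such that `ze` is equidimensional. -/
theorem exists_equidimensional_cut {A : Type u} [NormedRing A] [StarRing A] [CStarRing A]
    [NormedAlgebra ℂ A] [StarModule ℂ A] [CompleteSpace A]
    (hAW : IsAWStarRing A) (e ce : A)
    (he : ProperlyInfinite e) (hce : IsCentralCover e ce) :
    ∃ z : A, IsCentralProj z ∧ z ≠ 0 ∧ ProjLE z ce ∧ Equidimensional (z * e) := by
  by_contra hno
  have hprop : ∀ z, IsCentralProj z → z * e ≠ 0 → ProperlyInfinite (z * e) := by
    intro z hz hze
    refine ⟨central_mul_proj hz he.1, hze, fun y hy hyz => ?_⟩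
    rw [← mul_assoc] at hyz ⊢
    exact he.2.2 _ (central_mul hy hz) hyz
  have hno' : ∀ z, IsCentralProj z → z * e ≠ 0 → ¬ Equidimensional (z * e) := by
    intro z hz hze heq
    have h1 : z * ce * e = z * e := by
      rw [mul_assoc, ProjLE.left' he.1 hce.1.1 hce.2.1]
    refine hno ⟨z * ce, central_mul hz hce.1, ?_, ?_, by rwa [h1]⟩
    · intro h; rw [h, zero_mul] at h1; exact hze h1.symm
    · rw [ProjLE, mul_assoc, hce.1.1.2]
  have h1c : IsCentralProj (1 : A) := ⟨⟨star_one A, mul_one 1⟩, fun a => by simp⟩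
  -- minimal dimension
  let D : Set Cardinal.{u} := {δ | ∃ z, IsCentralProj z ∧ z * e ≠ 0 ∧ projDim (z * e) = δ}
  have hDne : D.Nonempty := ⟨_, 1, h1c, by simpa using he.2.1, rfl⟩
  obtain ⟨z0, hz0, hz0e, hδ⟩ := Cardinal.lt_wf.min_mem D hDne
  set δ := Cardinal.lt_wf.min D hDne with hδdef
  have hmin : ∀ z, IsCentralProj z → z * e ≠ 0 → δ ≤ projDim (z * e) := fun z hz hze =>
    not_lt.1 (Cardinal.lt_wf.not_lt_min D ⟨z, hz, hze, rfl⟩)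
  set f := z0 * e with hfdef
  have hf : IsProjection f := central_mul_proj hz0 he.1
  have hδ1 : 1 < δ := hδ ▸ one_lt_projDim hz0e hf
  have hstep : ∀ y, IsCentralProj y → y * f ≠ 0 →
      ∃ x, IsCentralProj x ∧ x * (y * f) ≠ 0 ∧ δ < projDim (x * (y * f)) := by
    intro y hy hyf
    have hyz : y * f = y * z0 * e := by rw [hfdef, mul_assoc]
    have hcy := central_mul hy hz0
    have hge := hmin _ hcy (by rwa [← hyz])
    rw [← hyz] at hge
    rcases hge.lt_or_eq with h | h
    · exact ⟨1, h1c, by simpa using hyf, by simpa using h⟩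
    · have h2 := hno' _ hcy (by rwa [← hyz])
      rw [← hyz] at h2
      have h3 : ProperlyInfinite (y * f) := by rw [hyz]; exact hprop _ hcy (by rwa [← hyz])
      simp only [Equidimensional, h3, true_and, not_forall] at h2
      obtain ⟨x, hx, hxf, hne⟩ := h2
      refine ⟨x, hx, hxf, lt_of_le_of_ne ?_ (by rw [h]; exact Ne.symm hne)⟩
      have := hmin _ (central_mul hx hcy) (by rwa [mul_assoc x, ← hyz])
      rwa [mul_assoc x, ← hyz] at this
  -- maximal orthogonal family
  let F : Set (Set A) := {Z | (∀ z ∈ Z, IsCentralProj z ∧ z * f ≠ 0 ∧ δ < projDim (z * f)) ∧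
    ∀ z ∈ Z, ∀ y ∈ Z, z ≠ y → z * y = 0}
  obtain ⟨Z, hZ⟩ := zorn_subset F (by
    intro c hc hchain
    refine ⟨⋃₀ c, ⟨?_, ?_⟩, fun s hs => Set.subset_sUnion_of_mem hs⟩
    · rintro z ⟨s, hs, hz⟩
      exact (hc hs).1 z hz
    · rintro z ⟨s, hs, hz⟩ y ⟨t, ht, hy⟩ hne
      rcases hchain.total hs ht with h | h
      · exact (hc ht).2 z (h hz) y hy hne
      · exact (hc hs).2 z hz y (h hy) hne)
  have hZF := hZ.prop
  obtain ⟨q, hq, hq1, hq2⟩ := exists_central_ann hAW Z fun z hz => (hZF.1 z hz).1.2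
  have hqf : q * f = 0 := by
    by_contra hqf
    obtain ⟨x, hx, hxf, hlt⟩ := hstep q hq hqf
    have hxq := central_mul hx hq
    rw [← mul_assoc] at hxf hlt
    have horth : ∀ z ∈ Z, z * (x * q) = 0 := fun z hz => by
      rw [← mul_assoc, ← hx.2, mul_assoc, hq1 z hz, mul_zero]
    have hins : insert (x * q) Z ∈ F := by
      refine ⟨?_, ?_⟩
      · rintro z (rfl | hz)
        · exact ⟨hxq, hxf, hlt⟩
        · exact hZF.1 z hz
      · rintro z (rfl | hz) y (rfl | hy) hne
        · exact absurd rfl hne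
        · rw [hxq.2]; exact horth y hy
        · exact horth z hz
        · exact hZF.2 z hz y hy hne
    have hmem : x * q ∈ Z := hZ.le_of_ge hins (Set.subset_insert _ _) (Set.mem_insert _ _)
    have h0 := horth _ hmem
    rw [hxq.1.2] at h0
    rw [h0, zero_mul] at hxf
    exact hxf rfl
  have hD : ∀ x, f * x = x → (∀ i : Z, (i : A) * x = 0) → x = 0 := by
    intro x hx h
    have := hq2 x fun z hz => h ⟨z, hz⟩
    rw [← this, ← hx, reas hqf, zero_mul]
  let K : Type u := (max δ Cardinal.aleph0).out
  have hK : Cardinal.mk K = max δ Cardinal.aleph0 := Cardinal.mk_out _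
  have : Infinite K := Cardinal.infinite_iff.2 (by rw [hK]; exact le_max_right _ _)
  have hfam : ∀ i : Z, ∃ p : K → A, Fam ((i : A) * f) p := fun i =>
    fam_of_lt (central_mul_proj (hZF.1 i i.2).1 hf) hδ1 (hZF.1 i i.2).2.2 hK
  choose p hp using hfam
  obtain ⟨E, hE⟩ := glue_fam (c := (2⁻¹ : ℂ) • (1 : A)) hAW (z := fun i : Z => (i : A))
    (fun i => (hZF.1 i i.2).1)
    (fun i j hij => hZF.2 i i.2 j j.2 fun h => hij (Subtype.ext h)) hf hD
    (by rw [← add_smul]; norm_num) (fun a => by simp) (by simp) p hp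
  obtain ⟨E', hE'⟩ := absorb hAW hf hE
  have h1 := lt_projDim hz0e hf hE'
  rw [hK, hδ] at h1
  exact absurd h1 (not_lt.2 (le_max_left _ _))
end

section
/- Let e be a properly infinite projection in an AW*-algebra A. Then there exists a family {z_α} of pairwise orthogonal central projections of A, indexed by infinite cardinals α, such that Σ z_α = c(e) and, for each α with z_α ≠ 0, the projection z_α e is equidimensional with d(z_α e) = α. In particular, e = Σ z_α e is a sum of pairwise orthogonal equidimensional projections. -/
universe u

namespace Deco

set_option linter.unusedSectionVars false
set_option linter.unusedVariables false

section Basic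

variable {A : Type u} [NormedRing A] [StarRing A] [CStarRing A]

/-- `s` is the annihilator-theoretic supremum of the family `p`. -/
def Sp {ι : Type*} (p : ι → A) (s : A) : Prop :=
  IsProjection s ∧ ∀ x, s * x = 0 ↔ ∀ i, p i * x = 0

/-- `w` implements an equivalence of projections `e`, `f`. -/
structure Tr (w e f : A) : Prop where
  pe : IsProjection e
  pf : IsProjection f
  ini : star w * w = e
  fin : w * star w = f
  we : w * e = w
  fw : f * w = w

lemma isProjection_zero : IsProjection (0 : A) := ⟨star_zero _, mul_zero _⟩

lemma isProjection_one : IsProjection (1 : A) := ⟨star_one _, mul_one _⟩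

lemma le_symm {e f : A} (he : IsProjection e) (hf : IsProjection f) (h : e * f = e) :
    f * e = e := by
  have := congrArg star h
  rwa [star_mul, he.1, hf.1] at this

lemma orth_symm {e f : A} (he : IsProjection e) (hf : IsProjection f) (h : e * f = 0) :
    f * e = 0 := by
  have := congrArg star h
  rwa [star_mul, he.1, hf.1, star_zero] at this

lemma isProjection_sub {e f : A} (he : IsProjection e) (hf : IsProjection f) (h : e * f = e) :
    IsProjection (f - e) := by
  refine ⟨by rw [star_sub, he.1, hf.1], ?_⟩
  rw [sub_mul, mul_sub, mul_sub, he.2, hf.2, h, le_symm he hf h]; abel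

lemma isProjection_add {e f : A} (he : IsProjection e) (hf : IsProjection f) (h : e * f = 0) :
    IsProjection (e + f) := by
  refine ⟨by rw [star_add, he.1, hf.1], ?_⟩
  rw [add_mul, mul_add, mul_add, he.2, hf.2, h, orth_symm he hf h]; abel

lemma isProjection_compl {e : A} (he : IsProjection e) : IsProjection (1 - e) :=
  isProjection_sub he isProjection_one (mul_one _)

lemma isProjection_central {z e : A} (hz : IsCentralProj z) (he : IsProjection e) :
    IsProjection (z * e) := by
  refine ⟨by rw [star_mul, he.1, hz.1.1, hz.2], ?_⟩
  rw [mul_assoc, ← mul_assoc e, ← hz.2 e, mul_assoc, he.2, ← mul_assoc, hz.1.2]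

lemma central_mul {z e : A} (hz : IsCentralProj z) (he : IsCentralProj e) :
    IsCentralProj (z * e) := by
  refine ⟨isProjection_central hz he.1, fun a => ?_⟩
  rw [mul_assoc, he.2, ← mul_assoc, hz.2, mul_assoc]

lemma central_compl {z : A} (hz : IsCentralProj z) : IsCentralProj (1 - z) := by
  refine ⟨isProjection_compl hz.1, fun a => ?_⟩
  rw [sub_mul, mul_sub, hz.2, one_mul, mul_one]

lemma Tr.of {w e f : A} (he : IsProjection e) (h1 : star w * w = e) (h2 : w * star w = f) :
    Tr w e f := by
  have h0 : w * e = w := by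
    have : star (w * e - w) * (w * e - w) = 0 := by
      have : star (w * e - w) * (w * e - w) =
          e * (star w * w) * e - e * (star w * w) - (star w * w) * e + star w * w := by
        rw [star_sub, star_mul, he.1]; noncomm_ring
      rw [this, h1, he.2, he.2]; abel
    exact sub_eq_zero.1 ((CStarRing.star_mul_self_eq_zero_iff _).1 this)
  refine ⟨he, ⟨?_, ?_⟩, h1, h2, h0, ?_⟩
  · rw [← h2]; simp
  · rw [← h2, mul_assoc, ← mul_assoc (star w), h1, ← mul_assoc, h0]
  · rw [← h2, mul_assoc, h1, h0]

lemma Tr.refl {e : A} (he : IsProjection e) : Tr e e e :=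
  Tr.of he (by rw [he.1, he.2]) (by rw [he.1, he.2])

lemma Tr.symm {w e f : A} (h : Tr w e f) : Tr (star w) f e :=
  Tr.of h.pf (by rw [star_star, h.fin]) (by rw [star_star, h.ini])

lemma Tr.es {w e f : A} (h : Tr w e f) : e * star w = star w := h.symm.fw
lemma Tr.sf {w e f : A} (h : Tr w e f) : star w * f = star w := h.symm.we

lemma Tr.trans {w v e f g : A} (h : Tr w e f) (h' : Tr v f g) : Tr (v * w) e g := by
  refine Tr.of h.pe ?_ ?_
  · rw [star_mul, mul_assoc, ← mul_assoc (star v), h'.ini, h.fw, h.ini]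
  · rw [star_mul, mul_assoc, ← mul_assoc w, h.fin, h'.es, h'.fin]

lemma Tr.res {w e f q : A} (h : Tr w e f) (hq : IsProjection q) (hqe : q * e = q) :
    Tr (w * q) q (w * q * star w) := by
  refine Tr.of hq ?_ ?_
  · rw [star_mul, hq.1, mul_assoc, ← mul_assoc (star w), h.ini, ← mul_assoc, hqe, hq.2]
  · rw [star_mul, hq.1, mul_assoc, ← mul_assoc q, hq.2, mul_assoc]

lemma Tr.add {w e f w' e' f' : A} (h : Tr w e f) (h' : Tr w' e' f') (h1 : e * e' = 0)
    (h2 : f * f' = 0) : Tr (w + w') (e + e') (f + f') := by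
  have a1 : star w * w' = 0 := by rw [← h.sf, ← h'.fw, mul_assoc, ← mul_assoc f, h2]; simp
  have a2 : star w' * w = 0 := by simpa using congrArg star a1
  have b1 : w * star w' = 0 := by rw [← h.we, ← h'.es, mul_assoc, ← mul_assoc e, h1]; simp
  have b2 : w' * star w = 0 := by simpa using congrArg star b1
  refine Tr.of (isProjection_add h.pe h'.pe h1) ?_ ?_
  · rw [star_add, add_mul, mul_add, mul_add, a1, a2, h.ini, h'.ini]; abel
  · rw [star_add, add_mul, mul_add, mul_add, b1, b2, h.fin, h'.fin]; abel

lemma Tr.central {w e f z : A} (h : Tr w e f) (hz : IsCentralProj z) :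
    Tr (z * w) (z * e) (z * f) := by
  refine Tr.of (isProjection_central hz h.pe) ?_ ?_
  · rw [star_mul, hz.1.1, mul_assoc, ← mul_assoc z, hz.1.2, hz.2, ← mul_assoc, h.ini, hz.2]
  · rw [star_mul, hz.1.1, mul_assoc, ← mul_assoc w, h.fin, ← hz.2, ← mul_assoc, hz.1.2]

lemma Tr.zero_iff {w e f : A} (h : Tr w e f) : e = 0 ↔ f = 0 := by
  constructor
  · intro h0; rw [← h.fin, ← h.we, h0]; simp
  · intro h0; rw [← h.ini, ← h.fw, h0]; simp

lemma Tr.le_of {w e f q : A} (h : Tr w e f) (hq : f * q = f) : star w * q = star w := by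
  rw [← h.sf, mul_assoc, hq]

lemma Tr.conj_le {w e f x q : A} (h : Tr w e f) (hq : f * q = f) :
    w * x * star w * q = w * x * star w := by
  rw [mul_assoc, h.le_of hq]

/-- conjugation multiplies -/
lemma Tr.conj_mul {w e f x y : A} (h : Tr w e f) (hx : x * e = x) :
    (w * x * star w) * (w * y * star w) = w * (x * y) * star w := by
  calc _ = w * (x * (star w * w)) * y * star w := by noncomm_ring
    _ = _ := by rw [h.ini, hx]; noncomm_ring

end Basic

section Sups

variable {A : Type u} [NormedRing A] [StarRing A] [CStarRing A]

lemma Sp.exists (hAW : IsAWStarRing A) {ι : Type*} (p : ι → A) : ∃ s, Sp p s := by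
  obtain ⟨q, hq, h⟩ := hAW (Set.range p)
  refine ⟨1 - q, isProjection_compl hq, fun x => ?_⟩
  have hx : (∀ i, p i * x = 0) ↔ ∃ b, x = q * b := by
    have := Set.ext_iff.1 h x
    simpa using this
  rw [hx, sub_mul, one_mul, sub_eq_zero]
  constructor
  · intro h; exact ⟨x, h⟩
  · rintro ⟨b, rfl⟩; rw [← mul_assoc, hq.2]

variable {ι : Type*} {p q : ι → A} {s t : A}

lemma Sp.le (h : Sp p s) (i : ι) : p i * s = p i := by
  have := (h.2 (1 - s)).1 (by rw [mul_sub, h.1.2, mul_one, sub_self]) i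
  rw [mul_sub, mul_one, sub_eq_zero] at this
  exact this.symm

lemma Sp.le_of (h : Sp p s) {x : A} (hx : ∀ i, p i * x = p i) : s * x = s := by
  have := (h.2 (1 - x)).2 (fun i => by rw [mul_sub, hx, mul_one, sub_self])
  rw [mul_sub, mul_one, sub_eq_zero] at this
  exact this.symm

lemma Sp.ext (h : Sp p s) {x y : A} (hx : ∀ i, p i * x = p i * y) : s * x = s * y := by
  have := (h.2 (x - y)).2 (fun i => by rw [mul_sub, hx, sub_self])
  rwa [mul_sub, sub_eq_zero] at this

lemma Sp.isSup (h : Sp p s) : IsSupProj p s := ⟨h.1, h.le, fun _ _ ht => h.le_of ht⟩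

lemma Sp.unique (h : Sp p s) (h' : Sp p t) : s = t := by
  have h1 : s * t = s := h.le_of h'.le
  have h2 : t * s = t := h'.le_of h.le
  rw [← h1]; exact le_symm h'.1 h.1 h2

lemma Sp.left (h : Sp p s) (hp : ∀ i, IsProjection (p i)) {x : A} (hx : ∀ i, x * p i = 0) :
    x * s = 0 := by
  have := (h.2 (star x)).2 (fun i => by
    have := congrArg star (hx i)
    rwa [star_mul, (hp i).1, star_zero] at this)
  have := congrArg star this
  rwa [star_mul, h.1.1, star_star, star_zero] at this

lemma Sp.orth {κ : Type*} {r : κ → A} (h : Sp p s) (hp : ∀ i, IsProjection (p i)) (h' : Sp r t)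
    (hpr : ∀ i j, p i * r j = 0) (hr : ∀ i, IsProjection (r i)) : s * t = 0 :=
  (h.2 t).2 fun i => h'.left hr (hpr i)

lemma Sp.conj (h : Sp p s) {w e f : A} (hw : Tr w e f) (hp : ∀ i, IsProjection (p i))
    (hpe : ∀ i, p i * e = p i) :
    Sp (fun i => w * p i * star w) (w * s * star w) := by
  have hse : s * e = s := h.le_of hpe
  refine ⟨(hw.res h.1 hse).pf, fun x => ?_⟩
  have key : ∀ q, IsProjection q → q * e = q → (w * q * star w * x = 0 ↔ q * (star w * x) = 0) := by
    intro q hq hqe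
    constructor
    · intro h0
      calc q * (star w * x) = e * q * (star w * x) := by rw [le_symm hq hw.pe hqe]
        _ = star w * (w * q * star w * x) := by rw [← hw.ini]; noncomm_ring
        _ = 0 := by rw [h0, mul_zero]
    · intro h0
      calc w * q * star w * x = w * (q * (star w * x)) := by noncomm_ring
        _ = 0 := by rw [h0, mul_zero]
  rw [key s h.1 hse, h.2]
  exact forall_congr' fun i => (key _ (hp i) (hpe i)).symm

lemma Sp.central (h : Sp p s) {z : A} (hz : IsCentralProj z) :
    Sp (fun i => z * p i) (z * s) := by
  refine ⟨isProjection_central hz h.1, fun x => ?_⟩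
  simp only [hz.2, mul_assoc]
  exact h.2 _

lemma Sp.reindex {κ : Type*} (h : Sp p s) (f : κ ≃ ι) : Sp (fun k => p (f k)) s := by
  refine ⟨h.1, fun x => ?_⟩
  rw [h.2]
  exact ⟨fun h k => h _, fun h i => by simpa using h (f.symm i)⟩

lemma Sp.add (h : Sp p s) (h' : Sp q t) (hp : ∀ i, IsProjection (p i))
    (hq : ∀ i, IsProjection (q i)) (ho : ∀ i j, p i * q j = 0) :
    Sp (fun i => p i + q i) (s + t) := by
  have hst : s * t = 0 := h.orth hp h' ho hq
  have key : ∀ a b x : A, IsProjection a → IsProjection b → a * b = 0 →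
      ((a + b) * x = 0 ↔ a * x = 0 ∧ b * x = 0) := by
    intro a b x ha hb hab
    constructor
    · intro h0
      have h1 : a * x = 0 := by
        calc a * x = a * ((a + b) * x) := by rw [← mul_assoc, mul_add, ha.2, hab, add_zero]
          _ = 0 := by rw [h0, mul_zero]
      refine ⟨h1, ?_⟩
      rwa [add_mul, h1, zero_add] at h0
    · rintro ⟨h1, h2⟩; rw [add_mul, h1, h2, add_zero]
  refine ⟨isProjection_add h.1 h'.1 hst, fun x => ?_⟩
  rw [key _ _ _ h.1 h'.1 hst, h.2, h'.2, ← forall_and]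
  exact forall_congr' fun i => (key _ _ _ (hp i) (hq i) (ho i i)).symm

lemma Sp.isCentral (h : Sp p s) (hp : ∀ i, IsCentralProj (p i)) : IsCentralProj s := by
  have key : ∀ a, s * a = s * a * s := by
    intro a
    have : s * (a * (1 - s)) = 0 := (h.2 _).2 fun i => by
      rw [← mul_assoc, (hp i).2, mul_assoc, mul_sub, h.le, mul_one, sub_self, mul_zero]
    rw [mul_sub, mul_one, mul_sub, sub_eq_zero, ← mul_assoc] at this
    exact this
  refine ⟨h.1, fun a => ?_⟩
  have h2 := congrArg star (key (star a))
  simp only [star_mul, star_star, h.1.1] at h2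
  rw [key a, h2, mul_assoc]

end Sups

end Deco

namespace Deco

section OAdd

set_option linter.unusedSectionVars false

variable {A : Type u} [NormedRing A] [StarRing A] [CStarRing A] [NormedAlgebra ℂ A]
  [StarModule ℂ A]

lemma exists_half : ∃ h : A, h + h = 1 ∧ star h = h ∧ ∀ a : A, h * a = a * h := by
  refine ⟨algebraMap ℂ A (1/2), ?_, ?_, fun a => Algebra.commutes _ _⟩
  · rw [← map_add]; norm_num
  · rw [← algebraMap_star_comm]; simp

/-- Orthogonal additivity of equivalence. -/
theorem oadd (hAW : IsAWStarRing A) {ι : Type*} {w e f : ι → A} {E F : A}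
    (hw : ∀ i, Tr (w i) (e i) (f i)) (he : PairwiseOrthogonal e) (hf : PairwiseOrthogonal f)
    (hE : Sp e E) (hF : Sp f F) (hEF : E * F = 0) : ∃ W, Tr W E F := by
  obtain ⟨h, h2, hs, hc⟩ := exists_half (A := A)
  have pe := fun i => (hw i).pe
  have pf := fun i => (hw i).pf
  have hFE : F * E = 0 := orth_symm hE.1 hF.1 hEF
  have ef : ∀ i j, e i * f j = 0 := fun i j => by
    rw [← hE.le i, mul_assoc, ← le_symm (pf j) hF.1 (hF.le j), ← mul_assoc E, hEF]; simp
  have fe : ∀ i j, f i * e j = 0 := fun i j => orth_symm (pe j) (pf i) (ef j i)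
  let g : ι → A := fun i => h * (e i + f i + w i + star (w i))
  have eg : ∀ i, e i * g i = h * (e i + star (w i)) := fun i => by
    have : e i * w i = 0 := by rw [← (hw i).fw, ← mul_assoc, ef, zero_mul]
    simp only [g]
    rw [← mul_assoc, ← hc, mul_assoc]
    simp only [mul_add, (pe i).2, ef, this, (hw i).es, add_zero]
  have fg : ∀ i, f i * g i = h * (f i + w i) := fun i => by
    have : f i * star (w i) = 0 := by rw [← (hw i).es, ← mul_assoc, fe, zero_mul]
    simp only [g]
    rw [← mul_assoc, ← hc, mul_assoc]
    simp only [mul_add, (pf i).2, fe, this, (hw i).fw, add_zero, zero_add]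
  have efg : ∀ i, (e i + f i) * g i = g i := fun i => by
    rw [add_mul, eg, fg]; simp only [g, mul_add]; abel
  have ww : ∀ i, w i * w i = 0 := fun i => by
    rw [← (hw i).we, mul_assoc, ← (hw i).fw, ← mul_assoc (e i), ← mul_assoc (e i), ef]; simp
  have sg : ∀ i, star (g i) = g i := fun i => by
    simp only [g, star_mul, star_add, (pe i).1, (pf i).1, star_star, hs]
    rw [← hc]; congr 1; abel
  have wg : ∀ i, w i * g i = f i * g i := fun i => by
    rw [fg]; simp only [g]
    rw [← mul_assoc, ← hc, mul_assoc]
    have : w i * f i = 0 := by rw [← (hw i).we, mul_assoc, ef, mul_zero]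
    simp only [mul_add, (hw i).we, this, ww, (hw i).fin, mul_zero]; abel
  have swg : ∀ i, star (w i) * g i = e i * g i := fun i => by
    rw [eg]; simp only [g]
    rw [← mul_assoc, ← hc, mul_assoc]
    have h1 : star (w i) * e i = 0 := by rw [← (hw i).sf, mul_assoc, fe, mul_zero]
    have h3 : star (w i) * star (w i) = 0 := by rw [← star_mul, ww, star_zero]
    simp only [mul_add, (hw i).sf, h1, h3, (hw i).ini, mul_zero]; abel
  have gg : ∀ i, g i * g i = g i := fun i => by
    have : g i * g i = h * ((e i + f i) * g i + w i * g i + star (w i) * g i) := by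
      conv_lhs => lhs; simp only [g]
      rw [mul_assoc]; simp only [add_mul]
    rw [this, wg, swg, add_assoc, ← add_mul, add_comm (f i), efg, ← one_mul (g i), ← h2]
    simp only [add_mul, mul_add, one_mul, ← mul_assoc]
    have : h * g i = h * h * g i + h * h * g i := by
      rw [← add_mul, ← mul_add, h2, mul_one]
    rw [← this]
  have pg : ∀ i, IsProjection (g i) := fun i => ⟨sg i, gg i⟩
  obtain ⟨G, hG⟩ := Sp.exists hAW g
  have hGE : ∀ i, (e i + f i) * G = g i := fun i => by
    have : (e i + f i - g i) * G = 0 := hG.left pg fun j => by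
      by_cases hij : i = j
      · subst hij; rw [sub_mul, efg, gg, sub_self]
      · rw [← efg j, ← mul_assoc, sub_mul]
        have h1 : (e i + f i) * (e j + f j) = 0 := by
          simp [add_mul, mul_add, he i j hij, hf i j hij, ef, fe]
        have h3 : g i * (e j + f j) = 0 := by
          have : g i = g i * (e i + f i) := by
            have := congrArg star (efg i)
            rw [star_mul, star_add, (pe i).1, (pf i).1, sg] at this
            exact this.symm
          rw [this, mul_assoc, h1, mul_zero]
        rw [h1, h3]; simp
    rw [sub_mul, hG.le, sub_eq_zero] at this
    exact this
  have geq : ∀ i, g i * (E + F) = g i := fun i => by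
    have h1 : w i * E = w i := by
      rw [← (hw i).we, mul_assoc, hE.le]
    have h3 : w i * F = 0 := by
      rw [← (hw i).we, mul_assoc, ← hE.le, mul_assoc, hEF]; simp
    have h4 : star (w i) * F = star (w i) := (hw i).le_of (hF.le i)
    have h5 : star (w i) * E = 0 := by
      rw [← (hw i).sf, mul_assoc, ← hF.le, mul_assoc, hFE]; simp
    have h6 : e i * F = 0 := by rw [← hE.le, mul_assoc, hEF, mul_zero]
    have h7 : f i * E = 0 := by rw [← hF.le, mul_assoc, hFE, mul_zero]
    simp only [g, mul_assoc]
    simp only [add_mul, mul_add, h1, h3, h4, h5, h6, h7, hE.le, hF.le, mul_zero]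
    abel
  have GEF : G * (E + F) = G := hG.le_of geq
  have EGE : E * G * E = h * E := by
    have : E * (G * E) = E * (h * E) := hE.ext fun i => by
      have h5 : star (w i) * E = 0 := by
        rw [← (hw i).sf, mul_assoc, ← hF.le, mul_assoc, hFE]; simp
      have : e i * G = h * (e i + star (w i)) := by
        rw [← eg, ← hGE, ← mul_assoc, mul_add, (pe i).2, ef, add_zero]
      rw [← mul_assoc, this, mul_assoc, add_mul, h5, hE.le, add_zero, ← mul_assoc, ← hc, mul_assoc,
        hE.le]
    rw [mul_assoc, this, ← mul_assoc, ← hc, mul_assoc, hE.1.2]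
  have FGF : F * G * F = h * F := by
    have : F * (G * F) = F * (h * F) := hF.ext fun i => by
      have h5 : w i * F = 0 := by
        rw [← (hw i).we, mul_assoc, ← hE.le, mul_assoc, hEF]; simp
      have : f i * G = h * (f i + w i) := by
        rw [← fg, ← hGE, ← mul_assoc, mul_add, (pf i).2, fe, zero_add]
      rw [← mul_assoc, this, mul_assoc, add_mul, h5, hF.le, add_zero, ← mul_assoc, ← hc, mul_assoc,
        hF.le]
    rw [mul_assoc, this, ← mul_assoc, ← hc, mul_assoc, hF.1.2]
  -- general computation
  have comp : ∀ P Q : A, P * P = P → G * (P + Q) = G → P * G * P = h * P →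
      (P * G * Q * (Q * G * P)) = h * h * P ∨ Q * Q ≠ Q := by
    intro P Q hP hPQ hPG
    by_cases hQ : Q * Q = Q
    · left
      have : P * G * Q * (Q * G * P) = P * (G * (P + Q)) * G * P - P * G * P * (P * G * P) := by
        calc P * G * Q * (Q * G * P) = P * G * (Q * Q) * (G * P) := by noncomm_ring
          _ = P * (G * (P + Q)) * G * P - P * G * (P * P) * (G * P) := by rw [hQ, hP]; noncomm_ring
          _ = _ := by noncomm_ring
      rw [this, hPQ, mul_assoc P G G, hG.1.2, hPG]
      have h3 : h * P * (h * P) = h * h * P := by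
        rw [mul_assoc, ← mul_assoc P, ← hc, mul_assoc h P P, hP, ← mul_assoc]
      rw [h3]
      have : h * P = h * h * P + h * h * P := by
        rw [← add_mul, ← mul_add, h2, mul_one]
      nth_rewrite 1 [this]; abel
    · right; exact hQ
  have c1 := (comp E F hE.1.2 GEF EGE).resolve_right (by simpa using hF.1.2)
  have c2 := (comp F E hF.1.2 (by rw [add_comm]; exact GEF) FGF).resolve_right
    (by simpa using hE.1.2)
  have four : ∀ P : A, (h * h * P + h * h * P) + (h * h * P + h * h * P) = P := fun P => by
    have : h * h * P + h * h * P = h * P := by rw [← add_mul, ← mul_add, h2, mul_one]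
    rw [this, ← add_mul, h2, one_mul]
  refine ⟨F * G * E + F * G * E, Tr.of hE.1 ?_ ?_⟩
  · simp only [star_add, star_mul, hE.1.1, hF.1.1, hG.1.1, add_mul, mul_add, ← mul_assoc]
    rw [← mul_assoc, ← mul_assoc] at c1
    rw [c1, four]
  · simp only [star_add, star_mul, hE.1.1, hF.1.1, hG.1.1, add_mul, mul_add, ← mul_assoc]
    rw [← mul_assoc, ← mul_assoc] at c2
    rw [c2, four]

end OAdd

end Deco

namespace Deco

section PI

set_option linter.unusedSectionVars false

lemma pi_aux {A : Type u} [CStarAlgebra A] (hAW : IsAWStarRing A) (x : A) (hx : x ≠ 0) :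
    ∃ y p : A, p ≠ 0 ∧ IsProjection p ∧ star (x * y) * (x * y) = p ∧ 
      (∀ f, x * f = x → p * f = p) := by
  set a := star x * x with ha
  have ha0 : a ≠ 0 := fun h => hx ((CStarRing.star_mul_self_eq_zero_iff _).1 h)
  have sa : IsSelfAdjoint a := IsSelfAdjoint.star_mul_self x
  have hpos : ∀ t ∈ spectrum ℝ a, 0 ≤ t := spectrum_star_mul_self_nonneg
  set ε : ℝ := ‖a‖ / 2 with hε
  have hε0 : 0 < ε := by have := norm_pos_iff.2 ha0; positivity
  have hm : ∀ t : ℝ, max t ε ≠ 0 := fun t => (lt_of_lt_of_le hε0 (le_max_right _ _)).ne'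
  have hsm : ∀ t : ℝ, Real.sqrt (max t ε) ≠ 0 := fun t =>
    (Real.sqrt_pos.2 (lt_of_lt_of_le hε0 (le_max_right _ _))).ne'
  let k : ℝ → ℝ := fun t => max (t - ε) 0 / max t ε
  let hh : ℝ → ℝ := fun t => (Real.sqrt (max t ε))⁻¹
  have ck : Continuous k := by
    apply Continuous.div (by fun_prop) (by fun_prop) hm
  have chh : Continuous hh := by
    apply Continuous.inv₀ (by fun_prop) hsm
  set K := cfc k a with hK
  set H := cfc hh a with hH
  set b := K * a with hb
  have hba : b = cfc (fun t => k t * t) a := by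
    rw [hb, hK, cfc_mul k (fun t => t) a (by fun_prop) (by fun_prop), cfc_id' ℝ a]
  have hab : b = a * K := by
    rw [hba, show (fun t => k t * t) = fun t => t * k t from by ext; ring, hK,
      cfc_mul (fun t => t) k a (by fun_prop) (by fun_prop), cfc_id' ℝ a]
  have sb : star b = b := by
    rw [hba]; exact (cfc_predicate (R := ℝ) _ a : IsSelfAdjoint _)
  have sH : star H = H := (cfc_predicate (R := ℝ) _ a : IsSelfAdjoint _)
  have hHaH : H * a * H = cfc (fun t => hh t * t * hh t) a := by
    rw [cfc_mul (fun t => hh t * t) hh a (by fun_prop) (by fun_prop),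
      cfc_mul hh (fun t => t) a (by fun_prop) (by fun_prop), cfc_id' ℝ a]
  have hHb : b * (H * a * H) = b := by
    rw [hHaH, hba, ← cfc_mul _ _ a (by fun_prop) (by fun_prop)]
    congr 1; ext t
    rcases le_total t ε with h | h
    · simp [k, max_eq_right (sub_nonpos.2 h)]
    · have h0 : 0 < t := lt_of_lt_of_le hε0 h
      have : hh t * t * hh t = 1 := by
        simp only [hh, max_eq_left h]
        have := Real.mul_self_sqrt h0.le
        have h2 := (Real.sqrt_pos.2 h0).ne'
        field_simp
        nlinarith
      rw [this, mul_one]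
  have hb0 : b ≠ 0 := by
    intro h0
    have h1 : a = cfc (fun t => t - k t * t) a := by
      rw [cfc_sub (fun t => t) _ a (by fun_prop) (by fun_prop), ← hba, h0, cfc_id' ℝ a, sub_zero]
    have h2 : ‖cfc (fun t => t - k t * t) a‖ ≤ ε := by
      refine norm_cfc_le hε0.le fun t ht => ?_
      have ht0 := hpos t ht
      rcases le_total t ε with h | h
      · simp [k, max_eq_right (sub_nonpos.2 h), abs_of_nonneg ht0, h]
      · have h0 : 0 < t := lt_of_lt_of_le hε0 h
        simp only [k, max_eq_left h, max_eq_left (sub_nonneg.2 h)]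
        rw [div_mul_cancel₀ _ h0.ne', sub_sub_cancel, Real.norm_eq_abs, abs_of_pos hε0]
    rw [← h1, hε] at h2
    have := norm_pos_iff.2 ha0
    linarith
  obtain ⟨p, hp⟩ := Sp.exists hAW (fun _ : Unit => b)
  have hp2 : ∀ y, p * y = 0 ↔ b * y = 0 := fun y => by rw [hp.2]; simp
  have hpne : p ≠ 0 := by
    rintro rfl
    apply hb0
    simpa using (hp2 1).1 (by simp)
  have hpc : p * (H * a * H) = p := hp.le_of fun _ => hHb
  have hcomm : (H * a * H) * p = p := by
    have := congrArg star hpc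
    rw [star_mul, hp.1.1, star_mul, star_mul, sH, sa.star_eq, ← mul_assoc] at this
    exact this
  refine ⟨H * p, p, hpne, hp.1, ?_, ?_⟩
  · calc star (x * (H * p)) * (x * (H * p)) = star p * star H * (star x * x) * (H * p) := by
          simp only [star_mul]; noncomm_ring
      _ = p * (H * a * H) * p := by rw [hp.1.1, sH, ← ha]; simp only [mul_assoc]
      _ = p := by rw [hpc, hp.1.2]
  · intro f hf
    refine hp.le_of fun _ => ?_
    rw [hb, ha, mul_assoc, mul_assoc, hf]

variable {A : Type u} [NormedRing A] [StarRing A] [CStarRing A] [NormedAlgebra ℂ A]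
  [StarModule ℂ A] [CompleteSpace A]

lemma pi_exists (hAW : IsAWStarRing A) (x e f : A) (hx : x ≠ 0) (he : e * x = x)
    (hf : x * f = x) (pe : IsProjection e) (pf : IsProjection f) :
    ∃ v p q : A, Tr v p q ∧ p ≠ 0 ∧ p * f = p ∧ q * e = q := by
  letI : CStarAlgebra A := { (inferInstance : NormedRing A), (inferInstance : StarRing A),
    (inferInstance : NormedAlgebra ℂ A), (inferInstance : CompleteSpace A),
    (inferInstance : CStarRing A), (inferInstance : StarModule ℂ A) with }
  obtain ⟨y, p, hp0, hp, h1, h2⟩ := pi_aux hAW x hx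
  have ht := Tr.of hp h1 rfl
  refine ⟨x * y, p, _, ht, hp0, h2 f hf, ?_⟩
  have h3 : e * (x * y * star (x * y)) = x * y * star (x * y) := by
    rw [← mul_assoc, ← mul_assoc, he]
  have := congrArg star h3
  rwa [star_mul, ht.pf.1, pe.1] at this

end PI

end Deco

namespace Deco

section GC

set_option linter.unusedSectionVars false

lemma zorn_aux {X : Type*} (P : X → Prop) (r : X → X → Prop) (S₀ : Set X)
    (h₀ : ∀ x ∈ S₀, P x) (hr : S₀.Pairwise r) :
    ∃ S : Set X, S₀ ⊆ S ∧ (∀ x ∈ S, P x) ∧ S.Pairwise r ∧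
      ∀ x, P x → (∀ y ∈ S, r x y ∧ r y x) → x ∈ S := by
  obtain ⟨S, hS, hmax⟩ := zorn_subset_nonempty
    {S : Set X | (∀ x ∈ S, P x) ∧ S.Pairwise r} (by
      intro c hc hchain hne
      refine ⟨⋃₀ c, ⟨?_, ?_⟩, fun s hs => Set.subset_sUnion_of_mem hs⟩
      · rintro x ⟨s, hs, hx⟩; exact (hc hs).1 x hx
      · rw [Set.pairwise_sUnion hchain.directedOn]
        exact fun s hs => (hc hs).2) S₀ ⟨h₀, hr⟩
  refine ⟨S, hS, hmax.prop.1, hmax.prop.2, fun x hx hxy => ?_⟩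
  have : insert x S ⊆ S := hmax.2 (y := insert x S) ⟨by
      rintro y (rfl | hy)
      · exact hx
      · exact hmax.prop.1 y hy, by
      refine hmax.prop.2.insert fun y hy _ => hxy y hy⟩ (Set.subset_insert _ _)
  exact this (Set.mem_insert _ _)

variable {A : Type u} [NormedRing A] [StarRing A] [CStarRing A] [NormedAlgebra ℂ A]
  [StarModule ℂ A] [CompleteSpace A]

/-- Generalized comparability for orthogonal projections. -/
theorem gcomp (hAW : IsAWStarRing A) {e f : A} (he : IsProjection e) (hf : IsProjection f)
    (hef : e * f = 0) :
    ∃ z w₁ q₁ w₂ q₂ : A, IsCentralProj z ∧ Tr w₁ (z * e) q₁ ∧ q₁ * (z * f) = q₁ ∧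
      Tr w₂ ((1 - z) * f) q₂ ∧ q₂ * ((1 - z) * e) = q₂ := by
  obtain ⟨S, -, hP, hr, hmax⟩ := zorn_aux
    (fun w : A => Tr w (star w * w) (w * star w) ∧ star w * w * e = star w * w ∧
      w * star w * f = w * star w)
    (fun v w : A => (star v * v) * (star w * w) = 0 ∧ (v * star v) * (w * star w) = 0)
    ∅ (by simp) (by simp)
  obtain ⟨E, hE⟩ := Sp.exists hAW (fun w : S => star w.1 * w.1)
  obtain ⟨F, hF⟩ := Sp.exists hAW (fun w : S => w.1 * star w.1)
  have hEe : E * e = E := hE.le_of fun w => (hP w w.2).2.1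
  have hFf : F * f = F := hF.le_of fun w => (hP w w.2).2.2
  have hEF : E * F = 0 := by
    rw [← hEe, ← le_symm hF.1 hf hFf, mul_assoc, ← mul_assoc e, hef]; simp
  obtain ⟨W, hW⟩ := oadd hAW (fun w : S => (hP w w.2).1)
    (fun v w hvw => (hr v.2 w.2 (fun h => hvw (Subtype.ext h))).1)
    (fun v w hvw => (hr v.2 w.2 (fun h => hvw (Subtype.ext h))).2) hE hF hEF
  have pe' := isProjection_sub hE.1 he hEe
  have pf' := isProjection_sub hF.1 hf hFf
  have hzero : ∀ a : A, (f - F) * a * (e - E) = 0 := by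
    intro a
    by_contra h0
    obtain ⟨v, p, q, hv, hp0, hpe, hqf⟩ := pi_exists hAW _ (f - F) (e - E) h0
      (by rw [← mul_assoc, ← mul_assoc, pf'.2]) (by rw [mul_assoc, pe'.2]) pf' pe'
    have hpE : p * E = 0 := by
      rw [← hpe, mul_assoc, sub_mul, hE.1.2, le_symm hE.1 he hEe, sub_self, mul_zero]
    have hqF : q * F = 0 := by
      rw [← hqf, mul_assoc, sub_mul, hF.1.2, le_symm hF.1 hf hFf, sub_self, mul_zero]
    have hvS : v ∈ S := by
      refine hmax v ⟨by rw [hv.ini, hv.fin]; exact hv, ?_, ?_⟩ ?_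
      · rw [hv.ini, ← hpe, mul_assoc, sub_mul, he.2, hEe]
      · rw [hv.fin, ← hqf, mul_assoc, sub_mul, hf.2, hFf]
      · intro y hy
        have h1 : p * (star y * y) = 0 := by
          have := hE.le ⟨y, hy⟩
          simp only at this
          rw [← le_symm (hP y hy).1.pe hE.1 this, ← mul_assoc, hpE, zero_mul]
        have h2 : q * (y * star y) = 0 := by
          have := hF.le ⟨y, hy⟩
          simp only at this
          rw [← le_symm (hP y hy).1.pf hF.1 this, ← mul_assoc, hqF, zero_mul]
        rw [hv.ini, hv.fin]
        exact ⟨⟨h1, h2⟩, orth_symm hv.pe (hP y hy).1.pe h1, orth_symm hv.pf (hP y hy).1.pf h2⟩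
    have := hE.le ⟨v, hvS⟩
    simp only [hv.ini] at this
    exact hp0 (this.symm.trans hpE)
  -- central projection: support of `(f - F) A`
  obtain ⟨c, hc⟩ := Sp.exists hAW (fun a : A => (f - F) * a)
  have hcc : IsCentralProj c := by
    have key : ∀ a, c * a = c * a * c := by
      intro a
      have : c * (a * (1 - c)) = 0 := (hc.2 _).2 fun i => by
        have : (f - F) * (i * a) * c = (f - F) * (i * a) := hc.le (i * a)
        rw [← mul_assoc, mul_assoc _ i a, mul_sub, this, mul_one, sub_self]
      rw [mul_sub, mul_one, mul_sub, sub_eq_zero, ← mul_assoc] at this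
      exact this
    refine ⟨hc.1, fun a => ?_⟩
    have h2 := congrArg star (key (star a))
    simp only [star_mul, star_star, hc.1.1] at h2
    rw [key a, h2, mul_assoc]
  have hce : c * (e - E) = 0 := (hc.2 _).2 hzero
  have hcf : (1 - c) * (f - F) = 0 := by
    have := hc.le 1
    rw [mul_one, ← hcc.2] at this
    rw [sub_mul, one_mul, this, sub_self]
  have hcc' := central_compl hcc
  have h1 : c * e = c * E := by rwa [mul_sub, sub_eq_zero] at hce
  have h2 : (1 - c) * f = (1 - c) * F := by rwa [mul_sub, sub_eq_zero] at hcf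
  refine ⟨c, _, _, _, _, hcc, by rw [h1]; exact hW.central hcc, ?_,
    by rw [h2]; exact hW.symm.central hcc', ?_⟩
  · rw [hcc.2 f, ← mul_assoc, mul_assoc c F f, hFf, mul_assoc, ← hcc.2, ← mul_assoc, hcc.1.2]
  · rw [hcc'.2 e, ← mul_assoc, mul_assoc _ E e, hEe, mul_assoc, ← hcc'.2, ← mul_assoc, hcc'.1.2]

end GC

end Deco

namespace Deco

section Halving

set_option linter.unusedSectionVars false

variable {A : Type u} [NormedRing A] [StarRing A] [CStarRing A] [NormedAlgebra ℂ A]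
  [StarModule ℂ A] [CompleteSpace A]

lemma seq_exists {w e f g₀ : A} (hw : Tr w e f) (hfe : f * e = f) (hg : IsProjection g₀)
    (hge : g₀ * e = g₀) (hgf : g₀ * f = 0) :
    ∃ g : ℕ → A, g 0 = g₀ ∧ (∀ n, g (n + 1) = w * g n * star w) ∧ (∀ n, IsProjection (g n)) ∧
      (∀ n, g n * e = g n) ∧ PairwiseOrthogonal g ∧ ∀ n, ∃ v, Tr v g₀ (g n) := by
  let g : ℕ → A := fun n => Nat.rec g₀ (fun _ x => w * x * star w) n
  have hs : ∀ n, g (n + 1) = w * g n * star w := fun n => rfl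
  have hall : ∀ n, IsProjection (g n) ∧ g n * e = g n ∧ ∃ v, Tr v g₀ (g n) := by
    intro n
    induction n with
    | zero => exact ⟨hg, hge, g₀, Tr.refl hg⟩
    | succ n ih =>
      obtain ⟨h1, h2, v, h3⟩ := ih
      rw [hs]
      have := hw.res h1 h2
      exact ⟨this.pf, hw.conj_le hfe, _, h3.trans this⟩
  have h0 : ∀ n, g 0 * g (n + 1) = 0 := fun n => by
    rw [hs, ← hw.fw]
    calc g₀ * (f * w * g n * star (f * w)) = g₀ * f * (w * g n * star (f * w)) := by noncomm_ring
      _ = 0 := by rw [hgf, zero_mul]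
  have hlt : ∀ n m, g n * g (n + 1 + m) = 0 := by
    intro n
    induction n with
    | zero => intro m; rw [zero_add, add_comm]; exact h0 m
    | succ n ih =>
      intro m
      rw [show n + 1 + 1 + m = (n + 1 + m) + 1 by ring, hs, hs, hw.conj_mul (hall n).2.1, ih]
      simp
  refine ⟨g, rfl, hs, fun n => (hall n).1, fun n => (hall n).2.1, ?_, fun n => (hall n).2.2⟩
  intro n m hnm
  rcases lt_or_gt_of_ne hnm with h | h
  · obtain ⟨k, rfl⟩ := Nat.exists_eq_add_of_le (Nat.succ_le_of_lt h)
    exact hlt n k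
  · obtain ⟨k, rfl⟩ := Nat.exists_eq_add_of_le (Nat.succ_le_of_lt h)
    exact orth_symm (hall _).1 (hall _).1 (hlt m k)

/-- Schröder–Bernstein, in sandwich form. -/
lemma sandwich (hAW : IsAWStarRing A) {w e p q : A} (hw : Tr w e p) (hq : IsProjection q)
    (hpq : p * q = p) (hqe : q * e = q) : ∃ v, Tr v e q := by
  have hpe : p * e = p := by rw [← hpq, mul_assoc, hqe]
  have heq := le_symm hq hw.pe hqe
  have hr := isProjection_sub hq hw.pe hqe
  obtain ⟨g, hg0, hgs, hgp, hge, hgo, -⟩ := seq_exists hw hpe hr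
    (by rw [sub_mul, hw.pe.2, hqe])
    (by rw [sub_mul, le_symm hw.pf hw.pe hpe, le_symm hw.pf hq hpq, sub_self])
  obtain ⟨R, hR⟩ := Sp.exists hAW g
  have hRe : R * e = R := hR.le_of hge
  have heR := le_symm hR.1 hw.pe hRe
  have hC := hR.conj hw hgp hge
  have ho : g 0 * (w * R * star w) = 0 := by
    refine hC.left (fun n => ?_) (fun n => ?_)
    · rw [← hgs]; exact hgp _
    · rw [← hgs]; exact hgo _ _ (by simp)
  have hsum : R = g 0 + w * R * star w := by
    refine hR.unique ⟨isProjection_add (hgp 0) hC.1 ho, fun x => ?_⟩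
    constructor
    · intro hx
      have h1 : g 0 * x = 0 := by
        calc g 0 * x = g 0 * ((g 0 + w * R * star w) * x) := by
              rw [← mul_assoc, mul_add, (hgp 0).2, ho, add_zero]
          _ = 0 := by rw [hx, mul_zero]
      rw [add_mul, h1, zero_add, hC.2] at hx
      intro n
      cases n with
      | zero => exact h1
      | succ n => rw [hgs]; exact hx n
    · intro hx
      rw [add_mul, hx 0, zero_add, hC.2]
      intro n
      have := hx (n + 1)
      rwa [hgs] at this
  have h1 : Tr (e - R) (e - R) (e - R) := Tr.refl (isProjection_sub hR.1 hw.pe hRe)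
  have h2 := hw.res hR.1 hRe
  have h3 := h1.add h2 (by rw [sub_mul, heR, hR.1.2, sub_self]) (by
    have : R * (w * R * star w) = w * R * star w := by
      nth_rewrite 1 [hsum]
      rw [add_mul, ho, zero_add, hC.1.2]
    rw [sub_mul, this, ← mul_assoc, ← mul_assoc,
      show e * w = w by rw [← hw.fw, ← mul_assoc, le_symm hw.pf hw.pe hpe], sub_self])
  have h4 : w * R * star w = R - (e - q) := by
    rw [hg0] at hsum; exact eq_sub_of_add_eq' hsum.symm
  rw [h4, sub_add_cancel, show e - R + (R - (e - q)) = q by abel] at h3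
  exact ⟨_, h3⟩

/-- `e` contains two orthogonal copies of itself. -/
def Halv (e : A) : Prop :=
  ∃ u v a b : A, Tr u e a ∧ Tr v e b ∧ a * e = a ∧ b * e = b ∧ a * b = 0

lemma six_equiv (I : Type u) [Infinite I] : Nonempty (I ≃ Fin 6 × I) := by
  have h : Cardinal.mk (Fin 6 × I) = Cardinal.mk I := by
    rw [Cardinal.mk_prod]
    simp only [Cardinal.lift_uzero, Cardinal.mk_fin]
    have := Cardinal.aleph0_le_mk I
    simpa using Cardinal.mul_eq_right this
      ((Cardinal.nat_lt_aleph0 6).le.trans this) (by simp)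
  exact (Cardinal.eq.1 h).map Equiv.symm

lemma local_core (hAW : IsAWStarRing A) {I : Type u} [Infinite I] {G : I → A} {E s h q₀ : A}
    {j₀ : I} {w₁ q₁ : A}
    (hG : ∀ i j, ∃ v, Tr v (G i) (G j)) (hGo : PairwiseOrthogonal G) (hs : Sp G s)
    (hE : IsProjection E) (hsE : E = h + s) (hhs : h * s = 0) (hw : Tr w₁ h q₁)
    (hq : q₁ * G j₀ = q₁) : Halv E := by
  obtain ⟨φ⟩ := six_equiv I
  have pG : ∀ i, IsProjection (G i) := fun i => (hG i i).choose_spec.pe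
  let c : I → Fin 6 := fun j => (φ j).1
  choose T hT using fun P : Set (Fin 6) => Sp.exists hAW (fun k : c ⁻¹' P => G k)
  have sub_s : ∀ t, t * s = t → t * E = t ∨ False := by
    intro t ht
    left
    have hsh := orth_symm hw.pe hs.1 hhs
    rw [hsE, mul_add, ht, ← ht, mul_assoc, hsh]; simp
  have Torth : ∀ P Q, Disjoint P Q → T P * T Q = 0 := by
    intro P Q hPQ
    refine (hT P).orth (fun _ => pG _) (hT Q) (fun i j => hGo _ _ ?_) (fun _ => pG _)
    intro hij
    exact Set.disjoint_left.1 hPQ i.2 (by rw [hij]; exact j.2)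
  have Tle : ∀ P, T P * s = T P := fun P => (hT P).le_of fun k => hs.le _
  have Gle : ∀ j P, c j ∈ P → G j * T P = G j := fun j P hj => (hT P).le ⟨j, hj⟩
  have hcard : ∀ P : Set (Fin 6), P.Nonempty → Cardinal.mk (c ⁻¹' P) = Cardinal.mk I := by
    rintro P ⟨p, hp⟩
    refine le_antisymm (Cardinal.mk_set_le _) ?_
    refine Cardinal.mk_le_of_injective (f := fun i : I => (⟨φ.symm (p, i), by simpa [c] using hp⟩ : c ⁻¹' P)) ?_
    intro i j hij
    simpa using hij
  have Teq : ∀ P Q, Disjoint P Q → P.Nonempty → Q.Nonempty → ∃ W, Tr W (T P) (T Q) := by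
    intro P Q hPQ hP hQ
    obtain ⟨ψ⟩ := Cardinal.eq.1 ((hcard P hP).trans (hcard Q hQ).symm)
    have hQ' := (hT Q).reindex ψ
    choose w hw using fun i : c ⁻¹' P => hG i.1 (ψ i).1
    refine oadd hAW hw (fun i j hij => hGo _ _ fun h => hij (Subtype.ext h))
      (fun i j hij => hGo _ _ fun h => hij (ψ.injective (Subtype.ext h))) (hT P) hQ' (Torth _ _ hPQ)
  have Tuniv : ∀ P, T P + T Pᶜ = s := by
    intro P
    have ho := Torth P Pᶜ disjoint_compl_right
    refine Sp.unique (p := G) ⟨isProjection_add (hT P).1 (hT _).1 ho, fun x => ?_⟩ hs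
    constructor
    · intro hx
      have h1 : T P * x = 0 := by
        calc T P * x = T P * ((T P + T Pᶜ) * x) := by
              rw [← mul_assoc, mul_add, (hT P).1.2, ho, add_zero]
          _ = 0 := by rw [hx, mul_zero]
      rw [add_mul, h1, zero_add] at hx
      intro j
      by_cases hj : c j ∈ P
      · exact ((hT P).2 x).1 h1 ⟨j, hj⟩
      · exact ((hT _).2 x).1 hx ⟨j, hj⟩
    · intro hx
      rw [add_mul, ((hT P).2 x).2 fun _ => hx _, ((hT _).2 x).2 fun _ => hx _, add_zero]
  -- one copy
  have copy : ∀ i j k : Fin 6, i ∈ ({0, 1, 2} : Set (Fin 6)) → j ∉ ({0, 1, 2} : Set (Fin 6)) →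
      k ≠ i → k ≠ j → ∃ u q, Tr u E (q + (T {j} + T {i})) ∧ q * T {k} = q ∧ IsProjection q := by
    intro i j k hi hj hki hkj
    obtain ⟨v, hv⟩ := hG j₀ (φ.symm (k, j₀))
    have h1 := hv.res hw.pf hq
    have h2 := hw.trans h1
    have hqk := hv.conj_le (x := q₁) (Gle (φ.symm (k, j₀)) {k} (by simp [c]))
    obtain ⟨W1, hW1⟩ := Teq {0, 1, 2} {j} (by simpa using hj) ⟨0, by simp⟩ ⟨j, by simp⟩
    obtain ⟨W2, hW2⟩ := Teq {0, 1, 2}ᶜ {i} (by simp at hi ⊢; tauto) ⟨3, by simp⟩ ⟨i, by simp⟩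
    have hij : j ≠ i := by rintro rfl; exact hj hi
    have h3 := hW1.add hW2 (Torth _ _ disjoint_compl_right) (Torth _ _ (by simpa using hij))
    rw [Tuniv] at h3
    have h4 := h2.add h3 hhs (by
      rw [← hqk, mul_assoc, mul_add, Torth {k} {j} (by simpa using hkj),
        Torth {k} {i} (by simpa using hki)]; simp)
    rw [← hsE] at h4
    exact ⟨_, _, h4, hqk, h2.pf⟩
  obtain ⟨u, q, hu, hqk, pq⟩ := copy 0 3 2 (by simp) (by simp) (by decide) (by decide)
  obtain ⟨v, q', hv, hqk', pq'⟩ := copy 1 4 5 (by simp) (by simp) (by decide) (by decide)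
  have Ts : ∀ i j, i ≠ j → T {i} * T {j} = 0 := fun i j hij => Torth _ _ (by simpa using hij)
  have hqT : ∀ j, 2 ≠ j → q * T {j} = 0 := fun j hj => by
    rw [← hqk, mul_assoc, Ts _ _ hj, mul_zero]
  have hqT' : ∀ j, j ≠ 5 → T {j} * q' = 0 := fun j hj => by
    rw [← le_symm pq' (hT _).1 hqk', ← mul_assoc, Ts _ _ hj, zero_mul]
  refine ⟨u, v, _, _, hu, hv, (sub_s _ ?_).resolve_right id, (sub_s _ ?_).resolve_right id, ?_⟩
  · rw [add_mul, add_mul, Tle, Tle, ← hqk, mul_assoc, Tle]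
  · rw [add_mul, add_mul, Tle, Tle, ← hqk', mul_assoc, Tle]
  · have : q * q' = 0 := by rw [← hqk, mul_assoc, hqT' _ (by decide), mul_zero]
    simp [add_mul, mul_add, this, hqT, hqT', Ts]

end Halving

end Deco

namespace Deco

section Global

set_option linter.unusedSectionVars false

variable {A : Type u} [NormedRing A] [StarRing A] [CStarRing A] [NormedAlgebra ℂ A]
  [StarModule ℂ A] [CompleteSpace A]

lemma central_one : IsCentralProj (1 : A) := ⟨isProjection_one, fun a => by simp⟩

theorem local_halv (hAW : IsAWStarRing A) {e : A} (he : ProperlyInfinite e) :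
    ∃ z : A, IsCentralProj z ∧ z * e ≠ 0 ∧ Halv (z * e) := by
  obtain ⟨pe, he0, hinf⟩ := he
  have h1 := hinf 1 central_one (by simpa using he0)
  rw [one_mul] at h1
  unfold ProjFinite at h1
  push Not at h1
  obtain ⟨f, pf, ⟨w, hw1, hw2⟩, hfe, hne⟩ := h1
  have hw := Tr.of pe hw1 hw2
  have hg₀ := isProjection_sub pf pe hfe
  obtain ⟨g, hg0, hgs, hgp, hge, hgo, hgt⟩ := seq_exists hw hfe hg₀
    (by rw [sub_mul, pe.2, hfe]) (by rw [sub_mul, le_symm pf pe hfe, pf.2, sub_self])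
  set g₀ := e - f with hg₀def
  have hg₀ne : g₀ ≠ 0 := sub_ne_zero.2 hne.symm
  have hgne : ∀ n, g n ≠ 0 := fun n h => by
    obtain ⟨v, hv⟩ := hgt n
    exact hg₀ne (hv.zero_iff.2 h)
  have ginj : Function.Injective g := by
    intro n m hnm
    by_contra h
    have := hgo n m h
    rw [hnm, (hgp m).2] at this
    exact hgne m this
  obtain ⟨S, hS0, hP, hr, hmax⟩ := zorn_aux
    (fun q : A => IsProjection q ∧ q * e = q ∧ ∃ v, Tr v g₀ q) (fun p q : A => p * q = 0)
    (Set.range g) (by rintro _ ⟨n, rfl⟩; exact ⟨hgp n, hge n, hgt n⟩)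
    (by rintro _ ⟨n, rfl⟩ _ ⟨m, rfl⟩ h; exact hgo n m (fun h' => h (by rw [h'])))
  have hSinf : Infinite S := ((Set.infinite_range_of_injective ginj).mono hS0).to_subtype
  have hg₀S : g₀ ∈ S := hS0 ⟨0, hg0⟩
  obtain ⟨s, hs⟩ := Sp.exists hAW (fun q : S => q.1)
  have hse : s * e = s := hs.le_of fun q => (hP q q.2).2.1
  have hes := le_symm hs.1 pe hse
  have ph := isProjection_sub hs.1 pe hse
  have hhs : (e - s) * s = 0 := by rw [sub_mul, hes, hs.1.2, sub_self]
  have hhS : ∀ q ∈ S, (e - s) * q = 0 := fun q hq => by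
    have := hs.le ⟨q, hq⟩
    simp only at this
    rw [← le_symm (hP q hq).1 hs.1 this, ← mul_assoc, hhs, zero_mul]
  obtain ⟨z, w₁, q₁, w₂, q₂, hz, hw₁, hq₁, hw₂, hq₂⟩ := gcomp hAW ph hg₀ (hhS _ hg₀S)
  have hzg : z * g₀ ≠ 0 := by
    intro h0
    have hz' := central_compl hz
    rw [sub_mul, one_mul, h0, sub_zero] at hw₂
    have hq2h : q₂ * (e - s) = q₂ := by
      rw [← hq₂, hz'.2, mul_assoc, mul_assoc, ← hz'.2, ← mul_assoc (e - s), ← hz'.2, mul_assoc (1-z), ph.2]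
    have hq2s : q₂ * s = 0 := by rw [← hq2h, mul_assoc, hhs, mul_zero]
    have hmem : q₂ ∈ S := by
      refine hmax _ ⟨hw₂.pf, ?_, _, hw₂⟩ ?_
      · rw [← hq2h, mul_assoc, sub_mul, pe.2, hse]
      · intro y hy
        have : q₂ * y = 0 := by rw [← hq2h, mul_assoc, hhS y hy, mul_zero]
        exact ⟨this, orth_symm hw₂.pf (hP y hy).1 this⟩
    have := hs.le ⟨q₂, hmem⟩
    simp only at this
    exact hg₀ne (hw₂.zero_iff.2 (this.symm.trans hq2s))
  have hge₀ : g₀ * e = g₀ := (hP _ hg₀S).2.1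
  refine ⟨z, hz, ?_, ?_⟩
  · intro h0
    apply hzg
    rw [← le_symm hg₀ pe hge₀, ← mul_assoc, h0, zero_mul]
  · refine local_core hAW (I := S) (G := fun q : S => z * q.1) (s := z * s) (h := z * (e - s))
      (j₀ := ⟨g₀, hg₀S⟩) (q₀ := 0) ?_ ?_ (hs.central hz) (isProjection_central hz pe) ?_ ?_ hw₁ hq₁
    · intro i j
      obtain ⟨v, hv⟩ := (hP i i.2).2.2
      obtain ⟨v', hv'⟩ := (hP j j.2).2.2
      exact ⟨_, (hv.symm.trans hv').central hz⟩
    · intro i j hij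
      have : i.1 * j.1 = 0 := hr i.2 j.2 (fun h => hij (Subtype.ext h))
      simp only
      rw [hz.2 j.1, mul_assoc, ← mul_assoc i.1, this]; simp
    · rw [← mul_add, sub_add_cancel]
    · rw [hz.2 s, mul_assoc, ← mul_assoc (e - s), hhs]; simp

lemma central_orth {z z' x y : A} (hz : IsCentralProj z) (hz' : IsCentralProj z')
    (hzz : z * z' = 0) (hx : x * z = x) (hy : y * z' = y) : x * y = 0 := by
  rw [← hx, ← hy, ← hz'.2 y, mul_assoc, ← mul_assoc z, hzz]; simp

lemma glob_half (hAW : IsAWStarRing A) {ι : Type*} {z u v a b : ι → A} {e a' : A}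
    (pe : IsProjection e) (hz : ∀ i, IsCentralProj (z i)) (hzo : PairwiseOrthogonal z)
    (hze : Sp (fun i => z i * e) e) (hu : ∀ i, Tr (u i) (z i * e) (a i))
    (hv : ∀ i, Tr (v i) (z i * e) (b i)) (ha : ∀ i, a i * (z i * e) = a i)
    (hb : ∀ i, b i * (z i * e) = b i) (hab : ∀ i, a i * b i = 0) (ha' : Sp a a') :
    ∃ W, Tr W e a' := by
  have pze : ∀ i, IsProjection (z i * e) := fun i => isProjection_central (hz i) pe
  have pa := fun i => (hu i).pf
  have pb := fun i => (hv i).pf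
  have zez : ∀ i, z i * e * z i = z i * e := fun i => by
    rw [← (hz i).2, ← mul_assoc, (hz i).1.2]
  have le_z : ∀ i x, x * (z i * e) = x → x * z i = x := fun i x hx => by
    rw [← hx, mul_assoc, zez]
  have cross : ∀ i j x y, i ≠ j → x * (z i * e) = x → y * (z j * e) = y → x * y = 0 :=
    fun i j x y hij hx hy => central_orth (hz i) (hz j) (hzo i j hij) (le_z i x hx) (le_z j y hy)
  have crossall : ∀ (x y : ι → A), (∀ i, x i * (z i * e) = x i) → (∀ i, y i * (z i * e) = y i) →
      (∀ i, x i * y i = 0) → ∀ i j, x i * y j = 0 := by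
    intro x y hx hy hxy i j
    by_cases hij : i = j
    · subst hij; exact hxy i
    · exact cross i j _ _ hij (hx i) (hy j)
  have porth : ∀ (x : ι → A), (∀ i, x i * (z i * e) = x i) → PairwiseOrthogonal x :=
    fun x hx i j hij => cross i j _ _ hij (hx i) (hx j)
  have hae : a' * e = a' := ha'.le_of fun i => by
    rw [← ha i, mul_assoc, mul_assoc, pe.2]
  have hea := le_symm ha'.1 pe hae
  let r : ι → A := fun i => z i * e - a i
  have pr : ∀ i, IsProjection (r i) := fun i => isProjection_sub (pa i) (pze i) (ha i)
  have hr : ∀ i, r i * (z i * e) = r i := fun i => by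
    simp only [r]; rw [sub_mul, ha, (pze i).2]
  have hra : ∀ i, r i * a i = 0 := fun i => by
    simp only [r]; rw [sub_mul, le_symm (pa i) (pze i) (ha i), (pa i).2, sub_self]
  have hza : ∀ i, z i * a' = a i := fun i => by
    have h1 : a' * (z i * a') = a' * a i := ha'.ext fun j => by
      rw [← mul_assoc, ← (hz i).2, mul_assoc, ha'.le]
      by_cases hij : i = j
      · subst hij; rw [(hz i).2, le_z i _ (ha i), (pa i).2]
      · rw [cross j i _ _ (Ne.symm hij) (ha j) (ha i), (hz i).2, ← le_z j _ (ha j), mul_assoc,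
          hzo j i (Ne.symm hij), mul_zero]
    rw [le_symm (pa i) ha'.1 (ha'.le i), ← mul_assoc, ← (hz i).2, mul_assoc, ha'.1.2] at h1
    exact h1
  have hrS : Sp r (e - a') := by
    refine ⟨isProjection_sub ha'.1 pe hae, fun x => ?_⟩
    have hzr : ∀ i, z i * (e - a') = r i := fun i => by rw [mul_sub, hza]
    constructor
    · intro hx i
      rw [← hzr, mul_assoc, hx, mul_zero]
    · intro hx
      have : e * ((e - a') * x) = 0 := (hze.2 _).2 fun i => by
        rw [← mul_assoc, mul_assoc (z i), mul_sub, pe.2, hea, hzr, hx]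
      rwa [← mul_assoc, mul_sub, pe.2, hea] at this
  have hur := fun i => (hu i).res (pr i) (hr i)
  have hua := fun i => (hu i).res (pa i) (ha i)
  have hur_le : ∀ i, u i * r i * star (u i) * (z i * e) = u i * r i * star (u i) :=
    fun i => (hu i).conj_le (ha i)
  have hua_le : ∀ i, u i * a i * star (u i) * (z i * e) = u i * a i * star (u i) :=
    fun i => (hu i).conj_le (ha i)
  have under_a : ∀ i x, u i * x * star (u i) * a i = u i * x * star (u i) := fun i x =>
    (hu i).conj_le (pa i).2
  obtain ⟨r2, hr2⟩ := Sp.exists hAW (fun i => u i * r i * star (u i))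
  obtain ⟨a2, ha2⟩ := Sp.exists hAW (fun i => u i * a i * star (u i))
  obtain ⟨b', hb'⟩ := Sp.exists hAW b
  obtain ⟨W1, hW1⟩ := oadd hAW hur (porth _ hr) (porth _ hur_le) hrS hr2
    (hrS.orth pr hr2 (crossall _ _ hr hur_le fun i => by
      rw [← le_symm (hur i).pf (pa i) (under_a i _), ← mul_assoc, hra, zero_mul])
      fun i => (hur i).pf)
  obtain ⟨W2, hW2⟩ := oadd hAW (fun i => (hu i).symm.trans (hv i)) (porth _ ha) (porth _ hb)
    ha' hb' (ha'.orth pa hb' (crossall _ _ ha hb hab) pb)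
  obtain ⟨W3, hW3⟩ := oadd hAW (fun i => ((hv i).symm.trans (hu i)).trans (hua i)) (porth _ hb)
    (porth _ hua_le) hb' ha2 (hb'.orth pb ha2 (crossall _ _ hb hua_le fun i => by
      rw [← le_symm (hua i).pf (pa i) (under_a i _), ← mul_assoc,
        orth_symm (pa i) (pb i) (hab i), zero_mul]) fun i => (hua i).pf)
  have hro : ∀ i j, (u i * r i * star (u i)) * (u j * a j * star (u j)) = 0 :=
    crossall _ _ hur_le hua_le fun i => by
      rw [(hu i).conj_mul (hr i), hra]; simp
  have hsum := hr2.add ha2 (fun i => (hur i).pf) (fun i => (hua i).pf) hro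
  have hsum' : r2 + a2 = a' := by
    refine hsum.unique ?_
    convert ha' using 2 with i
    rw [← add_mul, ← mul_add, sub_add_cancel, (hu i).we, (hu i).fin]
  have := hW1.add (hW2.trans hW3) (by rw [sub_mul, hea, ha'.1.2, sub_self])
    (hr2.orth (fun i => (hur i).pf) ha2 hro fun i => (hua i).pf)
  rw [hsum', sub_add_cancel] at this
  exact ⟨_, this⟩

lemma glob_halv (hAW : IsAWStarRing A) {ι : Type*} {z : ι → A} {e : A}
    (pe : IsProjection e) (hz : ∀ i, IsCentralProj (z i)) (hzo : PairwiseOrthogonal z)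
    (hze : Sp (fun i => z i * e) e) (hH : ∀ i, Halv (z i * e)) : Halv e := by
  choose u v a b hu hv ha hb hab using hH
  obtain ⟨a', ha'⟩ := Sp.exists hAW a
  obtain ⟨b', hb'⟩ := Sp.exists hAW b
  have hba : ∀ i, b i * a i = 0 := fun i => orth_symm (hu i).pf (hv i).pf (hab i)
  obtain ⟨U, hU⟩ := glob_half hAW pe hz hzo hze hu hv ha hb hab ha'
  obtain ⟨V, hV⟩ := glob_half hAW pe hz hzo hze hv hu hb ha hba hb'
  have le_z : ∀ i x, x * (z i * e) = x → x * z i = x := fun i x hx => by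
    rw [← hx, mul_assoc, ← (hz i).2, ← mul_assoc, ← mul_assoc, mul_assoc x, (hz i).1.2, mul_assoc]
  refine ⟨U, V, a', b', hU, hV, ha'.le_of fun i => ?_, hb'.le_of fun i => ?_,
    ha'.orth (fun i => (hu i).pf) hb' (fun i j => ?_) fun i => (hv i).pf⟩
  · rw [← ha i, mul_assoc, mul_assoc, pe.2]
  · rw [← hb i, mul_assoc, mul_assoc, pe.2]
  · by_cases hij : i = j
    · subst hij; exact hab i
    · exact central_orth (hz i) (hz j) (hzo i j hij) (le_z _ _ (ha i)) (le_z _ _ (hb j))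

theorem halv_of_properlyInfinite (hAW : IsAWStarRing A) {e : A} (he : ProperlyInfinite e) :
    Halv e := by
  obtain ⟨S, -, hP, hr, hmax⟩ := zorn_aux
    (fun z : A => IsCentralProj z ∧ Halv (z * e)) (fun p q : A => p * q = 0) ∅ (by simp) (by simp)
  obtain ⟨Y, hY⟩ := Sp.exists hAW (fun z : S => z.1)
  have hYc : IsCentralProj Y := hY.isCentral fun z => (hP z z.2).1
  have hYc' := central_compl hYc
  have key : (1 - Y) * e = 0 := by
    by_contra h0
    have hpi : ProperlyInfinite ((1 - Y) * e) := by
      refine ⟨isProjection_central hYc' he.1, h0, fun z hz hz0 => ?_⟩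
      rw [← mul_assoc] at hz0 ⊢
      exact he.2.2 _ (central_mul hz hYc') hz0
    obtain ⟨z, hz, hz0, hzH⟩ := local_halv hAW hpi
    rw [← mul_assoc] at hz0 hzH
    have hzY : z * (1 - Y) * Y = 0 := by
      rw [mul_assoc, sub_mul, one_mul, hYc.1.2, sub_self, mul_zero]
    have hmem : z * (1 - Y) ∈ S := by
      refine hmax _ ⟨central_mul hz hYc', hzH⟩ fun y hy => ?_
      have : z * (1 - Y) * y = 0 := by
        have := hY.le ⟨y, hy⟩
        simp only at this
        rw [← le_symm (hP y hy).1.1 hY.1 this, ← mul_assoc, hzY, zero_mul]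
      exact ⟨this, orth_symm (central_mul hz hYc').1 (hP y hy).1.1 this⟩
    have := hY.le ⟨_, hmem⟩
    simp only at this
    rw [← this, hzY, zero_mul] at hz0
    exact hz0 rfl
  have hYe : Y * e = e := by rw [sub_mul, one_mul, sub_eq_zero] at key; exact key.symm
  refine glob_halv hAW (z := fun z : S => z.1) he.1 (fun z => (hP z z.2).1)
    (fun i j hij => hr i.2 j.2 fun h => hij (Subtype.ext h)) ?_ (fun z => (hP z z.2).2)
  refine ⟨he.1, fun x => ?_⟩
  rw [← hYe, mul_assoc, hY.2]
  simp only [hYe, mul_assoc]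

end Global

end Deco

namespace Deco

section Fin

set_option linter.unusedSectionVars false

variable {A : Type u} [NormedRing A] [StarRing A] [CStarRing A] [NormedAlgebra ℂ A]
  [StarModule ℂ A] [CompleteSpace A]

theorem add_of_halv (hAW : IsAWStarRing A) {e : A} (hH : Halv e) {ι : Type*} {w a b : ι → A}
    {E F : A} (hw : ∀ i, Tr (w i) (a i) (b i)) (ha : PairwiseOrthogonal a)
    (hb : PairwiseOrthogonal b) (hae : ∀ i, a i * e = a i) (hbe : ∀ i, b i * e = b i)
    (hE : Sp a E) (hF : Sp b F) : ∃ W, Tr W E F := by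
  obtain ⟨u, v, c, d, hu, hv, hc, hd, hcd⟩ := hH
  have pa := fun i => (hw i).pe
  have pb := fun i => (hw i).pf
  have hEe : E * e = E := hE.le_of hae
  have hFe : F * e = F := hF.le_of hbe
  have h1 := hE.conj hu pa hae
  have h2 := hF.conj hv pb hbe
  have hor : (u * E * star u) * (v * F * star v) = 0 := by
    have e1 : star u * v = 0 := by
      rw [← hu.sf, ← hv.fw, mul_assoc, ← mul_assoc c, hcd]; simp
    calc _ = u * E * (star u * v) * F * star v := by noncomm_ring
      _ = 0 := by rw [e1]; simp
  obtain ⟨W, hW⟩ := oadd hAW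
    (fun i => ((hu.res (pa i) (hae i)).symm.trans (hw i)).trans (hv.res (pb i) (hbe i)))
    (fun i j hij => by
      show u * a i * star u * (u * a j * star u) = 0
      rw [hu.conj_mul (hae i), ha i j hij]; simp)
    (fun i j hij => by
      show v * b i * star v * (v * b j * star v) = 0
      rw [hv.conj_mul (hbe i), hb i j hij]; simp)
    h1 h2 hor
  exact ⟨_, ((hu.res hE.1 hEe).trans hW).trans (hv.res hF.1 hFe).symm⟩

/-- `J`-many orthogonal copies of `e` fit inside `e`. -/
def Fits (e : A) (J : Type*) : Prop :=
  ∃ p w : J → A, (∀ j, Tr (w j) e (p j)) ∧ (∀ j, p j * e = p j) ∧ PairwiseOrthogonal p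

lemma Fits.mono {e : A} {J : Type*} {K : Type*} (h : Fits e J) (f : K → J)
    (hf : Function.Injective f) : Fits e K := by
  obtain ⟨p, w, h1, h2, h3⟩ := h
  exact ⟨fun k => p (f k), fun k => w (f k), fun k => h1 _, fun k => h2 _,
    fun i j hij => h3 _ _ fun h => hij (hf h)⟩

lemma Fits.nat {e : A} (hH : Halv e) : Fits e ℕ := by
  obtain ⟨u, v, c, d, hu, hv, hc, hd, hcd⟩ := hH
  obtain ⟨g, -, -, h3, h4, h5, h6⟩ := seq_exists hu hc hv.pf hd (orth_symm hu.pf hv.pf hcd)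
  choose x hx using h6
  exact ⟨g, fun n => x n * v, fun n => hv.trans (hx n), h4, h5⟩

lemma Fits.central {e z : A} {J : Type*} (h : Fits e J) (hz : IsCentralProj z) :
    Fits (z * e) J := by
  obtain ⟨p, w, h1, h2, h3⟩ := h
  refine ⟨fun k => z * p k, fun k => z * w k, fun k => (h1 k).central hz, fun k => ?_,
    fun i j hij => ?_⟩
  · show z * p k * (z * e) = z * p k
    rw [mul_assoc, ← mul_assoc (p k), ← hz.2, mul_assoc, h2, ← mul_assoc, hz.1.2]
  · show z * p i * (z * p j) = 0
    rw [mul_assoc, ← mul_assoc (p i), ← hz.2, mul_assoc, h3 i j hij]; simp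

lemma Fits.gamma (hAW : IsAWStarRing A) {e : A} {J : Type u} (h : Fits e J) (j₀ : J) :
    ∃ p : J → A, InGamma e p := by
  classical
  obtain ⟨p, w, h1, h2, h3⟩ := h
  have pe := (h1 j₀).pe
  have pp := fun j => (h1 j).pf
  obtain ⟨s, hs⟩ := Sp.exists hAW p
  have hse : s * e = s := hs.le_of h2
  have hes : e * s = s := le_symm hs.1 pe hse
  have pes := isProjection_sub hs.1 pe hse
  have hor : ∀ j, p j * (e - s) = 0 := fun j => by rw [mul_sub, h2, hs.le, sub_self]
  have hor' : ∀ j, (e - s) * p j = 0 := fun j => orth_symm (pp j) pes (hor j)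
  have hq := isProjection_add (pp j₀) pes (hor j₀)
  have hse' : (e - s) * e = e - s := by rw [sub_mul, pe.2, hse]
  have hqe : (p j₀ + (e - s)) * e = p j₀ + (e - s) := by
    rw [add_mul, h2, hse']
  obtain ⟨v, hv⟩ := sandwich hAW (h1 j₀) hq (by rw [mul_add, (pp j₀).2, hor, add_zero]) hqe
  have hpro : ∀ j, IsProjection (Function.update p j₀ (p j₀ + (e - s)) j) := by
    intro j
    by_cases hj : j = j₀
    · subst hj; simpa using hq
    · simpa [hj] using pp j
  refine ⟨Function.update p j₀ (p j₀ + (e - s)), hpro, ?_, ?_, pe, ?_, ?_⟩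
  · intro i j hij
    by_cases hi : i = j₀
    · subst hi
      have hj : j ≠ i := fun h => hij h.symm
      simp [hj, add_mul, h3 i j hij, hor']
    · by_cases hj : j = j₀
      · subst hj
        simp [hi, mul_add, h3 i j hij, hor]
      · simp [hi, hj, h3 i j hij]
  · intro j
    by_cases hj : j = j₀
    · subst hj
      refine ⟨star v, ?_⟩
      simpa using And.intro hv.fin hv.ini
    · refine ⟨star (w j), ?_⟩
      simpa [hj] using And.intro (h1 j).fin (h1 j).ini
  · intro j
    by_cases hj : j = j₀
    · subst hj; simpa [ProjLE] using hqe
    · simpa [ProjLE, hj] using h2 j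
  · intro t pt ht
    have h0 := ht j₀
    simp only [Function.update_self, ProjLE] at h0
    have e1 : (e - s) * t = e - s := by
      have := congrArg (fun x => (e - s) * x) h0
      simpa [← mul_assoc, mul_add, hor', pes.2] using this
    have e2 : p j₀ * t = p j₀ := by
      have := congrArg (fun x => p j₀ * x) h0
      simpa [← mul_assoc, mul_add, hor, (pp j₀).2] using this
    have e3 : s * t = s := hs.le_of fun j => by
      by_cases hj : j = j₀
      · subst hj; exact e2
      · simpa [ProjLE, hj] using ht j
    show e * t = e
    rw [sub_mul, e3] at e1
    exact sub_left_injective e1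

lemma Fits.of_gamma {e : A} (pe : IsProjection e) {J : Type u} {p : J → A} (h : InGamma e p) :
    Fits e J := by
  obtain ⟨h1, h2, h3, h4⟩ := h
  choose v hv1 hv2 using h3
  exact ⟨p, fun j => star (v j), fun j => (Tr.of (h1 j) (hv1 j) (hv2 j)).symm, h4.2.1, h2⟩

lemma fits_injective {e : A} (h0 : e ≠ 0) {J : Type*} {p w : J → A}
    (h1 : ∀ j, Tr (w j) e (p j)) (h3 : PairwiseOrthogonal p) : Function.Injective p := by
  intro i j hij
  by_contra hne
  have := h3 i j hne
  rw [← hij, (h1 i).pf.2] at this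
  exact h0 ((h1 i).zero_iff.2 this)

lemma lt_projDim (hAW : IsAWStarRing A) {e : A} (pe : IsProjection e) (h0 : e ≠ 0)
    (α : Cardinal.{u}) : α < projDim e ↔ Fits e α.out := by
  have hbdd : BddAbove {c : Cardinal.{u} |
      ∃ (ι : Type u) (p : ι → A), InGamma e p ∧ c = Order.succ (Cardinal.mk ι)} := by
    refine ⟨Order.succ (Cardinal.mk A), ?_⟩
    rintro c ⟨ι, p, hp, rfl⟩
    refine Order.succ_le_succ ?_
    obtain ⟨p, w, h1, h2, h3⟩ := Fits.of_gamma pe hp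
    exact Cardinal.mk_le_of_injective (fits_injective h0 h1 h3)
  have hd : projDim e = sSup {c : Cardinal.{u} |
      ∃ (ι : Type u) (p : ι → A), InGamma e p ∧ c = Order.succ (Cardinal.mk ι)} := by
    rw [projDim, if_neg h0]
  rw [hd]
  have hone : Fits e PUnit.{u+1} :=
    ⟨fun _ => e, fun _ => e, fun _ => Tr.refl pe, fun _ => pe.2, fun i j hij => (hij rfl).elim⟩
  constructor
  · intro h
    have hne : {c : Cardinal.{u} |
      ∃ (ι : Type u) (p : ι → A), InGamma e p ∧ c = Order.succ (Cardinal.mk ι)}.Nonempty := by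
      obtain ⟨p, hp⟩ := hone.gamma hAW PUnit.unit
      exact ⟨_, _, p, hp, rfl⟩
    obtain ⟨c, ⟨ι, p, hp, rfl⟩, hc⟩ := exists_lt_of_lt_csSup hne h
    have hc := Order.lt_succ_iff.1 hc
    rw [← Cardinal.mk_out α] at hc
    obtain ⟨f⟩ := hc
    exact (Fits.of_gamma pe hp).mono f f.injective
  · intro h
    by_cases hα : Nonempty α.out
    · obtain ⟨p, hp⟩ := h.gamma hAW hα.some
      have := le_csSup hbdd ⟨_, p, hp, rfl⟩
      rw [Cardinal.mk_out] at this
      exact lt_of_lt_of_le (Order.lt_succ α) this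
    · obtain ⟨p, hp⟩ := hone.gamma hAW PUnit.unit
      have := le_csSup hbdd ⟨_, p, hp, rfl⟩
      refine lt_of_lt_of_le (Order.lt_succ_iff.2 ?_) this
      have : α = 0 := by
        rw [← Cardinal.mk_out α]
        exact Cardinal.mk_eq_zero_iff.2 (not_nonempty_iff.1 hα)
      rw [this]; exact zero_le

lemma sp_central_mul {ι : Type*} {z : ι → A} {Y e : A} (pe : IsProjection e)
    (hY : Sp z Y) (hYc : IsCentralProj Y) : Sp (fun i => z i * e) (Y * e) := by
  refine ⟨isProjection_central hYc pe, fun x => ?_⟩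
  simp only [mul_assoc]
  exact hY.2 _

lemma Fits.sum (hAW : IsAWStarRing A) {e : A} (pe : IsProjection e) (hH : Halv e) {ι : Type*}
    {J : Type*} {z : ι → A} {Y : A} (hz : ∀ i, IsCentralProj (z i)) (hzo : PairwiseOrthogonal z)
    (hY : Sp z Y) (h : ∀ i, Fits (z i * e) J) : Fits (Y * e) J := by
  choose p w h1 h2 h3 using h
  have hYc := hY.isCentral hz
  have le_z : ∀ i x, x * (z i * e) = x → x * z i = x := fun i x hx => by
    rw [← hx, mul_assoc, ← (hz i).2, ← mul_assoc, ← mul_assoc, mul_assoc x, (hz i).1.2, mul_assoc]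
  have le_e : ∀ i x, x * (z i * e) = x → x * e = x := fun i x hx => by
    rw [← hx, mul_assoc, mul_assoc, pe.2]
  have hze : ∀ i, z i * e * e = z i * e := fun i => by rw [mul_assoc, pe.2]
  choose P hP using fun j => Sp.exists hAW (fun i => p i j)
  have hYe := sp_central_mul pe hY hYc
  have hor : ∀ i i' j j', i ≠ i' → p i j * p i' j' = 0 := fun i i' j j' hi =>
    central_orth (hz i) (hz i') (hzo i i' hi) (le_z _ _ (h2 i j)) (le_z _ _ (h2 i' j'))
  have hW : ∀ j, ∃ W, Tr W (Y * e) (P j) := fun j =>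
    add_of_halv hAW hH (fun i => h1 i j)
      (fun i i' hi => by
        show z i * e * (z i' * e) = 0
        rw [mul_assoc, ← mul_assoc e, ← (hz i').2, mul_assoc, ← mul_assoc, hzo i i' hi, zero_mul])
      (fun i i' hi => hor i i' j j hi) hze (fun i => le_e i _ (h2 i j)) hYe (hP j)
  choose W hW using hW
  refine ⟨P, W, hW, fun j => (hP j).le_of fun i => ?_, fun j j' hj => ?_⟩
  · have a1 : z i * e * (Y * e) = z i * e := hYe.le i
    rw [← h2 i j, mul_assoc, a1]
  · refine (hP j).orth (fun i => (h1 i j).pf) (hP j') (fun i i' => ?_) fun i => (h1 i j').pf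
    by_cases hi : i = i'
    · subst hi; exact h3 i j j' hj
    · exact hor i i' j j' hi

/-- the largest central projection under `c` on which `J` copies fit -/
lemma exists_y (hAW : IsAWStarRing A) {e c : A} (pe : IsProjection e) (hH : Halv e)
    (J : Type*) :
    ∃ y : A, IsCentralProj y ∧ y * c = y ∧
      ∀ z, IsCentralProj z → z * c = z → (Fits (z * e) J ↔ z * y = z) := by
  obtain ⟨S, -, hP, hr, hmax⟩ := zorn_aux
    (fun z : A => IsCentralProj z ∧ z * c = z ∧ Fits (z * e) J) (fun p q : A => p * q = 0) ∅
    (by simp) (by simp)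
  obtain ⟨Y, hY⟩ := Sp.exists hAW (fun z : S => z.1)
  have hYc : IsCentralProj Y := hY.isCentral fun z => (hP z z.2).1
  have hYc' := central_compl hYc
  have hYF : Fits (Y * e) J := Fits.sum hAW pe hH (fun z : S => (hP z z.2).1)
    (fun i j hij => hr i.2 j.2 fun h => hij (Subtype.ext h)) hY (fun z => (hP z z.2).2.2)
  refine ⟨Y, hYc, hY.le_of fun z => (hP z z.2).2.1, fun z hz hzc => ⟨fun h => ?_, fun h => ?_⟩⟩
  · have hc := central_mul hz hYc'
    have hzY : z * (1 - Y) * Y = 0 := by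
      rw [mul_assoc, sub_mul, one_mul, hYc.1.2, sub_self, mul_zero]
    have hmem : z * (1 - Y) ∈ S := by
      refine hmax _ ⟨hc, ?_, ?_⟩ fun y hy => ?_
      · rw [mul_assoc, hYc'.2, ← mul_assoc, hzc]
      · have := h.central hYc'
        rwa [← mul_assoc, ← hz.2] at this
      have : z * (1 - Y) * y = 0 := by
        have := hY.le ⟨y, hy⟩
        simp only at this
        rw [← le_symm (hP y hy).1.1 hY.1 this, ← mul_assoc, hzY, zero_mul]
      exact ⟨this, orth_symm hc.1 (hP y hy).1.1 this⟩
    have := hY.le ⟨_, hmem⟩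
    simp only at this
    rw [hzY, mul_sub, mul_one] at this
    exact (sub_eq_zero.1 this.symm).symm
  · have := hYF.central hz
    rwa [← mul_assoc, h] at this

end Fin

end Deco

/-- Any properly infinite projection decomposes as a sum of equidimensional
projections: there is a family `{z_α}` of pairwise orthogonal central
projections indexed by the (infinite) cardinals, with `Σ z_α = c(e)`, such that
whenever `z_α ≠ 0` the projection `z_α e` is equidimensional of dimension `α`;
in particular `e = Σ z_α e`. -/
theorem decomposition_into_equidimensionals {A : Type u} [NormedRing A] [StarRing A]
    [CStarRing A] [NormedAlgebra ℂ A] [StarModule ℂ A] [CompleteSpace A]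
    (hAW : IsAWStarRing A) (e ce : A)
    (he : ProperlyInfinite e) (hce : IsCentralCover e ce) :
    ∃ z : Cardinal.{u} → A,
      (∀ α, IsCentralProj (z α)) ∧
      (∀ α, ¬ Cardinal.aleph0 ≤ α → z α = 0) ∧
      PairwiseOrthogonal z ∧
      IsSupProj z ce ∧
      (∀ α, z α ≠ 0 → Equidimensional (z α * e) ∧ projDim (z α * e) = α) ∧
      IsSupProj (fun α => z α * e) e := by
  obtain ⟨hcc, hle, hmin⟩ := hce
  have pe := he.1
  have hH := Deco.halv_of_properlyInfinite hAW he
  choose y hyc hyle hy using fun α : Cardinal.{u} =>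
    Deco.exists_y hAW (c := ce) pe hH α.out
  choose t ht using fun α : Cardinal.{u} =>
    Deco.Sp.exists hAW (fun β : Set.Iio α => 1 - y β.1)
  have htc : ∀ α, IsCentralProj (t α) := fun α =>
    (ht α).isCentral fun β => Deco.central_compl (hyc β.1)
  have hzc : ∀ α, IsCentralProj (ce * (1 - t α) * (1 - y α)) := fun α =>
    Deco.central_mul (Deco.central_mul hcc (Deco.central_compl (htc α)))
      (Deco.central_compl (hyc α))
  -- characterization of subprojections of the pieces
  have hzle : ∀ α x, IsCentralProj x → x * ce = x →
      (x * (ce * (1 - t α) * (1 - y α)) = x ↔ (∀ β < α, x * y β = x) ∧ x * y α = 0) := by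
    intro α x hx hxc
    have e1 : x * (ce * (1 - t α) * (1 - y α)) = x * (1 - t α) * (1 - y α) := by
      rw [← mul_assoc, ← mul_assoc, hxc]
    rw [e1]
    have h3 : (x * t α = 0) ↔ ∀ β < α, x * y β = x := by
      rw [hx.2, (ht α).2]
      constructor
      · intro h β hβ
        have := h ⟨β, hβ⟩
        simp only [sub_mul, one_mul] at this
        rw [hx.2]; exact (sub_eq_zero.1 this).symm
      · intro h β
        have := h β.1 β.2
        rw [sub_mul, one_mul, ← hx.2, this, sub_self]
    rw [← h3]
    constructor
    · intro h
      constructor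
      · have h5 : (1 - t α) * t α = 0 := by rw [sub_mul, one_mul, (htc α).1.2, sub_self]
        rw [← h, mul_assoc, (Deco.central_compl (hyc α)).2 (t α), mul_assoc, ← mul_assoc (1 - t α),
          h5]
        simp
      · have h5 : (1 - y α) * y α = 0 := by rw [sub_mul, one_mul, (hyc α).1.2, sub_self]
        rw [← h, mul_assoc, h5, mul_zero]
    · rintro ⟨h1, h2⟩
      rw [mul_sub x, h1, mul_one, sub_zero, mul_sub, h2, mul_one, sub_zero]
  have hnz : ∀ x, IsCentralProj x → x * ce = x → x ≠ 0 → x * e ≠ 0 := by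
    intro x hx hxc hx0 h0
    have := hmin (1 - x) (Deco.central_compl hx) (by
      show e * (1 - x) = e
      rw [mul_sub, ← hx.2, h0, mul_one, sub_zero])
    have h2 : ce * (1 - x) = ce := this
    rw [mul_sub, mul_one, ← hx.2, hxc] at h2
    exact hx0 (by simpa using h2)
  have hdim : ∀ x, IsCentralProj x → x * ce = x → x ≠ 0 → ∀ α,
      (α < projDim (x * e) ↔ x * y α = x) := by
    intro x hx hxc hx0 α
    rw [Deco.lt_projDim hAW (Deco.isProjection_central hx pe) (hnz x hx hxc hx0), hy α x hx hxc]
  have hzself : ∀ α, ce * (1 - t α) * (1 - y α) * ce = ce * (1 - t α) * (1 - y α) := by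
    intro α
    rw [← hcc.2, ← mul_assoc, ← mul_assoc, hcc.1.2]
  have hz1 : ∀ α, (∀ β < α, ce * (1 - t α) * (1 - y α) * y β = ce * (1 - t α) * (1 - y α)) ∧
      ce * (1 - t α) * (1 - y α) * y α = 0 := fun α =>
    (hzle α _ (hzc α) (hzself α)).1 (hzc α).1.2
  have hsubdim : ∀ α x, IsCentralProj x → x * (ce * (1 - t α) * (1 - y α)) = x → x ≠ 0 →
      projDim (x * e) = α := by
    intro α x hx hxz hx0
    have hxc : x * ce = x := by rw [← hxz, mul_assoc, hzself]
    obtain ⟨h1, h2⟩ := (hzle α x hx hxc).1 hxz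
    have hd := hdim x hx hxc hx0
    apply le_antisymm
    · by_contra h
      have := (hd α).1 (not_le.1 h)
      exact hx0 (by rw [← this, h2])
    · by_contra h
      have h := not_le.1 h
      exact lt_irrefl _ ((hd _).2 (h1 _ h))
  have hcee : ce * e = e := Deco.le_symm pe hcc.1 hle
  have hce0 : ce ≠ 0 := fun h => he.2.1 (by rw [← hcee, h, zero_mul])
  have hor : PairwiseOrthogonal (fun α => ce * (1 - t α) * (1 - y α)) := by
    have key : ∀ α β, α < β →
        ce * (1 - t α) * (1 - y α) * (ce * (1 - t β) * (1 - y β)) = 0 := by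
      intro α β h
      rw [← (hz1 β).1 α h, ← (hyc α).2, ← mul_assoc, (hz1 α).2, zero_mul]
    intro α β h
    rcases lt_or_gt_of_ne h with h | h
    · exact key α β h
    · exact Deco.orth_symm (hzc β).1 (hzc α).1 (key β α h)
  obtain ⟨s, hs⟩ := Deco.Sp.exists hAW (fun α => ce * (1 - t α) * (1 - y α))
  have hsc : IsCentralProj s := hs.isCentral hzc
  have hsce : s * ce = s := hs.le_of hzself
  have hseq : s = ce := by
    by_contra hne
    have hr : IsCentralProj (ce * (1 - s)) := Deco.central_mul hcc (Deco.central_compl hsc)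
    have hrc : ce * (1 - s) * ce = ce * (1 - s) := by rw [← hcc.2, ← mul_assoc, hcc.1.2]
    have hr0 : ce * (1 - s) ≠ 0 := by
      intro h
      rw [mul_sub, mul_one, ← hsc.2, hsce] at h
      exact hne (sub_eq_zero.1 h).symm
    have hrs : ce * (1 - s) * s = 0 := by
      rw [mul_assoc, sub_mul, one_mul, hsc.1.2, sub_self, mul_zero]
    generalize ce * (1 - s) = r at hr hrc hr0 hrs
    have hd := hdim r hr hrc hr0
    generalize projDim (r * e) = α at hd
    have h1 : ∀ β < α, r * y β = r := fun β h => (hd β).1 h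
    have h2 : r * y α ≠ r := fun h => lt_irrefl _ ((hd α).2 h)
    have hyc' := Deco.central_compl (hyc α)
    have hq : r * (1 - y α) * (ce * (1 - t α) * (1 - y α)) = r * (1 - y α) := by
      refine (hzle α _ (Deco.central_mul hr hyc') ?_).2 ⟨fun β h => ?_, ?_⟩
      · rw [mul_assoc, hyc'.2, ← mul_assoc, hrc]
      · rw [mul_assoc, hyc'.2, ← mul_assoc, h1 β h]
      · rw [mul_assoc, sub_mul, one_mul, (hyc α).1.2, sub_self, mul_zero]
    have hzs : ce * (1 - t α) * (1 - y α) * s = ce * (1 - t α) * (1 - y α) := hs.le α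
    have h3 : r * (1 - y α) = 0 := by
      have h4 : r * (1 - y α) * s = 0 := by rw [mul_assoc, ← hsc.2, ← mul_assoc, hrs, zero_mul]
      rw [← hq, ← hzs, ← hsc.2, ← mul_assoc, h4, zero_mul]
    rw [mul_sub, mul_one] at h3
    exact h2 (sub_eq_zero.1 h3).symm
  rw [hseq] at hs
  refine ⟨fun α => ce * (1 - t α) * (1 - y α), hzc, ?_, hor, hs.isSup, ?_, ?_⟩
  · intro α hα
    have hf : α < Cardinal.aleph0 := not_le.1 hα
    have hF : Deco.Fits (ce * e) α.out := by
      rw [hcee]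
      have hc : Cardinal.mk α.out < Cardinal.aleph0 := by rwa [Cardinal.mk_out]
      have : Finite α.out := Cardinal.lt_aleph0_iff_finite.1 hc
      obtain ⟨f, hf⟩ := exists_injective_nat α.out
      exact (Deco.Fits.nat hH).mono f hf
    have h1 := (hy α ce hcc hcc.1.2).1 hF
    show ce * (1 - t α) * (1 - y α) = 0
    have h2 : ce * (1 - y α) = 0 := by rw [mul_sub, h1, mul_one, sub_self]
    rw [mul_assoc, (Deco.central_compl (htc α)).2, ← mul_assoc, h2, zero_mul]
  · intro α h0
    have h0 : ce * (1 - t α) * (1 - y α) ≠ 0 := h0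
    have hself := hsubdim α _ (hzc α) (hzc α).1.2 h0
    refine ⟨⟨⟨Deco.isProjection_central (hzc α) pe, hnz _ (hzc α) (hzself α) h0, ?_⟩, ?_⟩, hself⟩
    · intro x hx hx0
      rw [← mul_assoc] at hx0 ⊢
      exact he.2.2 _ (Deco.central_mul hx (hzc α)) hx0
    · intro x hx hx0
      show projDim (x * (ce * (1 - t α) * (1 - y α) * e)) =
        projDim (ce * (1 - t α) * (1 - y α) * e)
      rw [hself]
      have hx0 : x * (ce * (1 - t α) * (1 - y α) * e) ≠ 0 := hx0
      rw [← mul_assoc] at hx0 ⊢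
      refine hsubdim α _ (Deco.central_mul hx (hzc α)) ?_ fun h => hx0 (by rw [h, zero_mul])
      rw [mul_assoc, (hzc α).1.2]
  · have := (Deco.sp_central_mul pe hs hcc).isSup
    rwa [hcee] at this
end
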